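/- arXiv:1810.00185 — 2 statements merged into one kernel-verified Lean document; each statement's English description precedes it below -/
import Mathlib

section
/- For any integer n ≥ d+1, the subgraph of Γ(d) induced by the d-dimensional polytopes with n or n+1 vertices is connected and has diameter at most 6n−2; moreover, any two d-dimensional polytopes with exactly n vertices each are at distance at most 6n−4 in this subgraph. -/
open Set

/-- Points of `ℝ^d`. -/
abbrev Pt (d : ℕ) := Fin d → ℝ

/-- A polytope in `ℝ^d` is the convex hull of a finite set of points. -/
def IsPolytope (d : ℕ) (P : Set (Pt d)) : Prop :=
  ∃ S : Finset (Pt d), P = convexHull ℝ (S : Set (Pt d))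

/-- A set is `d`-dimensional (full-dimensional) if its affine hull is all of `ℝ^d`. -/
def FullDim (d : ℕ) (P : Set (Pt d)) : Prop := affineSpan ℝ P = ⊤

/-- A point `x` can be inserted in `P` when the convex hull of `P ∪ {x}` has as its
vertex set (set of extreme points) exactly the vertex set of `P` together with `x`. -/
def CanInsert (d : ℕ) (P : Set (Pt d)) (x : Pt d) : Prop :=
  Set.extremePoints ℝ (convexHull ℝ (P ∪ {x})) = Set.extremePoints ℝ P ∪ {x}

/-- A vertex `v` of `P` can be deleted from `P` when the convex hull of the remaining
vertices is `d`-dimensional. -/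
def CanDelete (d : ℕ) (P : Set (Pt d)) (v : Pt d) : Prop :=
  v ∈ Set.extremePoints ℝ P ∧
    FullDim d (convexHull ℝ (Set.extremePoints ℝ P \ {v}))

/-- `Q` is obtained from `P` by an insertion move. -/
def InsertMove (d : ℕ) (P Q : Set (Pt d)) : Prop :=
  ∃ x : Pt d, CanInsert d P x ∧ Q = convexHull ℝ (P ∪ {x})

/-- `Q` is obtained from `P` by a deletion move. -/
def DeleteMove (d : ℕ) (P Q : Set (Pt d)) : Prop :=
  ∃ v : Pt d, CanDelete d P v ∧ Q = convexHull ℝ (Set.extremePoints ℝ P \ {v})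

/-- Adjacency: one polytope is obtained from the other by inserting a point or
deleting a vertex. -/
def Move (d : ℕ) (P Q : Set (Pt d)) : Prop :=
  InsertMove d P Q ∨ DeleteMove d P Q ∨ InsertMove d Q P ∨ DeleteMove d Q P

/-- There is a path of at most `n` edges from `P` to `Q` all of whose vertices lie in
the class `C` of polytopes (i.e. `P` and `Q` are at distance at most `n` in the subgraph
induced by `C`). -/
def PathLE (d : ℕ) (C : Set (Set (Pt d))) (P Q : Set (Pt d)) (n : ℕ) : Prop :=
  ∃ (m : ℕ) (f : ℕ → Set (Pt d)), m ≤ n ∧ f 0 = P ∧ f m = Q ∧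
    (∀ i ≤ m, f i ∈ C) ∧ ∀ i < m, Move d (f i) (f (i + 1))

/-- The subgraph induced by the class `C` is connected. -/
def ConnectedIn (d : ℕ) (C : Set (Set (Pt d))) : Prop :=
  ∀ P ∈ C, ∀ Q ∈ C, ∃ n, PathLE d C P Q n

/-- The vertex set of the graph `Γ(d)`: the `d`-dimensional polytopes in `ℝ^d`. -/
def Gamma (d : ℕ) : Set (Set (Pt d)) := {P | IsPolytope d P ∧ FullDim d P}

/-- The number of vertices of a polytope. -/
noncomputable def nVerts (d : ℕ) (P : Set (Pt d)) : ℕ := (Set.extremePoints ℝ P).ncard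

/-- A lattice point of `ℝ^d`. -/
def IsLatticePt (d : ℕ) (x : Pt d) : Prop := ∀ i, ∃ z : ℤ, x i = (z : ℝ)

/-- A lattice polytope: all its vertices are lattice points. -/
def IsLatticePoly (d : ℕ) (P : Set (Pt d)) : Prop :=
  ∀ v ∈ Set.extremePoints ℝ P, IsLatticePt d v

/-- The hypercube `[0,k]^d`. -/
def Cube (d k : ℕ) : Set (Pt d) := {x | ∀ i, x i ∈ Set.Icc (0 : ℝ) (k : ℝ)}

/-- The vertex set of `Λ(d)`: the `d`-dimensional lattice polytopes in `ℝ^d`. -/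
def Lambda (d : ℕ) : Set (Set (Pt d)) :=
  {P | IsPolytope d P ∧ FullDim d P ∧ IsLatticePoly d P}

/-- The vertex set of `Λ(d,k)`: the `d`-dimensional lattice polytopes in `[0,k]^d`. -/
def LambdaK (d k : ℕ) : Set (Set (Pt d)) := {P ∈ Lambda d | P ⊆ Cube d k}

/-- A facet of a polytope `P`: an exposed face of dimension `d-1`. -/
def IsFacet (d : ℕ) (P F : Set (Pt d)) : Prop :=
  IsExposed ℝ P F ∧ F.Nonempty ∧ F ≠ P ∧
    Module.finrank ℝ ↥(vectorSpan ℝ F) = d - 1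

/-- `H` is the closed half-space `H_F^-(P)` bounded by the affine hull of the facet `F`
and satisfying `P ∩ H = F`. -/
def BoundingHalfspace (d : ℕ) (P F H : Set (Pt d)) : Prop :=
  ∃ (l : (Pt d) →ₗ[ℝ] ℝ) (c : ℝ), l ≠ 0 ∧
    H = {x | l x ≤ c} ∧
    (affineSpan ℝ F : Set (Pt d)) = {x | l x = c} ∧
    P ∩ H = F

/-- The cone `C_v(P)`: the intersection of the half-spaces `H_F^-(P)` over all facets
`F` of `P` incident to `v`. -/
def Cone (d : ℕ) (P : Set (Pt d)) (v : Pt d) : Set (Pt d) :=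
  {x | ∀ F H : Set (Pt d), IsFacet d P F → v ∈ F → BoundingHalfspace d P F H → x ∈ H}

/-- A set `A` is in convex position: every finite subset of `A` is the vertex set of
a polytope, namely of its own convex hull. -/
def ConvexPosition (d : ℕ) (A : Set (Pt d)) : Prop :=
  ∀ S : Finset (Pt d), (S : Set (Pt d)) ⊆ A →
    Set.extremePoints ℝ (convexHull ℝ (S : Set (Pt d))) = (S : Set (Pt d))

/-- The class of `d`-dimensional polytopes with `n` or `n + 1` vertices. -/
def NClass (d n : ℕ) : Set (Set (Pt d)) :=
  {P ∈ Gamma d | nVerts d P = n ∨ nVerts d P = n + 1}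

open Topology Filter

section Exposed

variable {E : Type*} [NormedAddCommGroup E] [NormedSpace ℝ E]

/-- Every member of the family is strictly separated from the others by a linear functional. -/
def ExposedFamily {ι : Type*} (z : ι → E) : Prop :=
  ∀ i, ∃ F : E →L[ℝ] ℝ, ∀ j, j ≠ i → F (z j) < F (z i)

/-- Every point of `T` is strictly separated from the others by a linear functional. -/
def ExposedSet (T : Set E) : Prop :=
  ∀ x ∈ T, ∃ F : E →L[ℝ] ℝ, ∀ y ∈ T, y ≠ x → F y < F x

lemma ExposedSet.mono {S T : Set E} (hT : ExposedSet T) (h : S ⊆ T) : ExposedSet S := fun x hx ↦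
  let ⟨F, hF⟩ := hT x (h hx)
  ⟨F, fun y hy ↦ hF y (h hy)⟩

lemma ExposedFamily.exposedSet_range {ι : Type*} {z : ι → E} (hz : ExposedFamily z) :
    ExposedSet (range z) := by
  rintro _ ⟨i, rfl⟩
  obtain ⟨F, hF⟩ := hz i
  refine ⟨F, ?_⟩
  rintro _ ⟨j, rfl⟩ hj
  exact hF j fun h ↦ hj (h ▸ rfl)

lemma ExposedFamily.eventually {ι : Type*} [Finite ι] {z : ι → E} (hz : ExposedFamily z) :
    ∀ᶠ z' in 𝓝 z, ExposedFamily z' := by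
  refine eventually_all.2 fun i ↦ ?_
  obtain ⟨F, hF⟩ := hz i
  have : ∀ᶠ z' in 𝓝 z, ∀ j, j ≠ i → F (z' j) < F (z' i) := by
    refine eventually_all.2 fun j ↦ ?_
    by_cases hj : j = i
    · simp [hj]
    · have h1 : Continuous fun z' : ι → E ↦ F (z' j) := by fun_prop
      have h2 : Continuous fun z' : ι → E ↦ F (z' i) := by fun_prop
      filter_upwards [(isOpen_lt h1 h2).mem_nhds (hF j hj)] with z' h _ using h
  exact this.mono fun z' h ↦ ⟨F, h⟩

lemma exists_forall_lt_of_notMem_convexHull {S : Set E} (hS : S.Finite) {x : E}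
    (hx : x ∉ convexHull ℝ S) : ∃ F : E →L[ℝ] ℝ, ∀ y ∈ S, F y < F x := by
  obtain ⟨F, u, h1, h2⟩ :=
    geometric_hahn_banach_closed_point (convex_convexHull ℝ S) (hS.isClosed_convexHull ℝ) hx
  exact ⟨F, fun y hy ↦ (h1 y (subset_convexHull ℝ S hy)).trans h2⟩

lemma convexHull_extremePoints_convexHull {S : Set E} (hS : S.Finite) :
    convexHull ℝ ((convexHull ℝ S).extremePoints ℝ) = convexHull ℝ S := by
  have h := closure_convexHull_extremePoints (hS.isCompact_convexHull ℝ) (convex_convexHull ℝ S)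
  rwa [((hS.subset extremePoints_convexHull_subset).isClosed_convexHull ℝ).closure_eq] at h

lemma ExposedSet.extremePoints_convexHull {T : Set E} (hT : ExposedSet T) (hfin : T.Finite) :
    (convexHull ℝ T).extremePoints ℝ = T := by
  refine extremePoints_convexHull_subset.antisymm fun x hx ↦ ?_
  by_contra hne
  obtain ⟨F, hF⟩ := hT x hx
  have h1 : convexHull ℝ T ⊆ {y | F y < F x} := by
    rw [← convexHull_extremePoints_convexHull hfin]
    refine convexHull_min (fun y hy ↦ ?_) (convex_halfSpace_lt F.toLinearMap.isLinear _)
    exact hF y (extremePoints_convexHull_subset hy) fun h ↦ hne (h ▸ hy)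
  exact lt_irrefl (F x) (h1 (subset_convexHull ℝ T hx))

lemma notMem_convexHull_insert_diff {V : Set E}
    (hV : (convexHull ℝ V).extremePoints ℝ = V) {a v : E} (ha : a ∈ convexHull ℝ V)
    (hv : v ∈ V) (hav : a ≠ v) : v ∉ convexHull ℝ (insert a (V \ {v})) := by
  intro h
  have hsub : convexHull ℝ (insert a (V \ {v})) ⊆ convexHull ℝ V :=
    convexHull_min (insert_subset ha (sdiff_subset.trans (subset_convexHull ℝ V)))
      (convex_convexHull ℝ V)
  have := extremePoints_convexHull_subset
    (inter_extremePoints_subset_extremePoints_of_subset hsub ⟨h, hV.symm ▸ hv⟩)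
  rcases this with h | h
  · exact hav h.symm
  · exact h.2 rfl

/-- Steinitz exchange for affine spans. -/
lemma affineSpan_insert_eq_top_of_notMem {S : Set E} {v x : E}
    (h : affineSpan ℝ (insert v S) = ⊤) (hx : x ∉ affineSpan ℝ S) :
    affineSpan ℝ (insert x S) = ⊤ := by
  rcases S.eq_empty_or_nonempty with rfl | ⟨p, hp⟩
  · have hxv : x ∈ affineSpan ℝ (insert v (∅ : Set E)) := h ▸ AffineSubspace.mem_top ℝ E x
    simp only [insert_empty_eq, AffineSubspace.mem_affineSpan_singleton] at hxv
    rw [hxv, h]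
  have hp' := mem_affineSpan ℝ hp
  have hxv : x ∈ affineSpan ℝ (insert v (affineSpan ℝ S : Set E)) := by
    rw [affineSpan_insert_affineSpan, h]; exact AffineSubspace.mem_top ℝ E x
  obtain ⟨r, q, hq, hxq⟩ := (AffineSubspace.mem_affineSpan_insert_iff hp' v x).1 hxv
  have hr : r ≠ 0 := by
    rintro rfl
    simp only [zero_smul, zero_vadd] at hxq
    exact hx (hxq ▸ hq)
  have hS : affineSpan ℝ S ≤ affineSpan ℝ (insert x S) := affineSpan_mono ℝ (subset_insert x S)
  have hv : v ∈ affineSpan ℝ (insert x S) := by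
    have := AffineSubspace.smul_vsub_vadd_mem _ r⁻¹ (mem_affineSpan ℝ (mem_insert x S))
      (hS hq) (hS hp')
    convert! this using 1
    rw [hxq]
    simp [smul_smul, hr]
  rw [eq_top_iff, ← h]
  refine affineSpan_le.2 (insert_subset hv fun y hy ↦ hS (mem_affineSpan ℝ hy))

end Exposed

section GeneralPosition

variable {E : Type*} [NormedAddCommGroup E] [NormedSpace ℝ E] [FiniteDimensional ℝ E]

lemma exists_mem_forall_notMem_affineSpan (F : Finset E) {x : E} {U : Set E} (hU : U ∈ 𝓝 x) :
    ∃ y ∈ U, ∀ S : Set E, S ⊆ F → affineSpan ℝ S ≠ ⊤ → y ∉ affineSpan ℝ S := by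
  borelize E
  let μ : MeasureTheory.Measure E := MeasureTheory.Measure.addHaar
  let B : Set E := ⋃ S ∈ {S : Set E | S ⊆ F ∧ affineSpan ℝ S ≠ ⊤}, (affineSpan ℝ S : Set E)
  have hfin : {S : Set E | S ⊆ F ∧ affineSpan ℝ S ≠ ⊤}.Finite :=
    F.finite_toSet.finite_subsets.subset fun S hS ↦ hS.1
  have hB : μ B = 0 := (MeasureTheory.measure_biUnion_null_iff hfin.countable).2 fun S hS ↦
    MeasureTheory.Measure.addHaar_affineSubspace μ _ hS.2
  have hUB : ¬ U ⊆ B := fun h ↦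
    (MeasureTheory.Measure.measure_pos_of_mem_nhds μ hU).ne' (MeasureTheory.measure_mono_null h hB)
  obtain ⟨y, hyU, hyB⟩ := not_subset.1 hUB
  refine ⟨y, hyU, fun S hS hS' hy ↦ hyB ?_⟩
  exact mem_biUnion (x := S) ⟨hS, hS'⟩ hy

/-- The points of `x` are in general position relatively to `F` and to their predecessors. -/
def GenericSeq (F : Set E) (x : ℕ → E) : Prop :=
  ∀ k, ∀ S ⊆ F ∪ x '' Iio k, affineSpan ℝ S ≠ ⊤ → x k ∉ affineSpan ℝ S

lemma exists_genericSeq (F : Finset E) {x : ℕ → E} {U : Set (ℕ → E)} (hU : U ∈ 𝓝 x) :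
    ∃ y ∈ U, GenericSeq (F : Set E) y := by
  classical
  rw [nhds_pi, Filter.mem_pi] at hU
  obtain ⟨I, -, t, ht, hIt⟩ := hU
  choose pick hpick1 hpick2 using fun (k : ℕ) (G : Finset E) ↦
    exists_mem_forall_notMem_affineSpan G (ht k)
  obtain ⟨G, hG0, hGs⟩ : ∃ G : ℕ → Finset E, G 0 = F ∧
      ∀ k, G (k + 1) = insert (pick k (G k)) (G k) :=
    ⟨fun k ↦ Nat.rec F (fun k G ↦ insert (pick k G) G) k, rfl, fun _ ↦ rfl⟩
  have hG : ∀ k, ((G k : Finset E) : Set E) = (F : Set E) ∪ (fun i ↦ pick i (G i)) '' Iio k := by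
    intro k
    induction k with
    | zero => simp [hG0]
    | succ k ih =>
      have hIio : Iio (k + 1) = insert k (Iio k) := by
        ext i
        simp [le_iff_eq_or_lt]
      rw [hGs, Finset.coe_insert, ih, hIio, image_insert_eq, union_insert]
  refine ⟨fun k ↦ pick k (G k), hIt fun k _ ↦ hpick1 k _, fun k S hS ↦ hpick2 k (G k) S ?_⟩
  rwa [hG]

end GeneralPosition

section Cap

variable {E : Type*} [NormedAddCommGroup E] [NormedSpace ℝ E]

/-- Points `A ε i` close to `a`, on a small strictly convex curve bulging in a direction in which
`f` increases, together with functionals `F ε i` close to `f` exposing them. -/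
lemma exists_cap (hE : 2 ≤ Module.finrank ℝ E) (a : E) {f : E →L[ℝ] ℝ} (hf : f ≠ 0) :
    ∃ (A : ℝ → ℕ → E) (F : ℝ → ℕ → E →L[ℝ] ℝ),
      Tendsto A (𝓝[>] 0) (𝓝 fun _ ↦ a) ∧
      (∀ i j, j ≠ i → ∀ᶠ ε in 𝓝[>] 0, F ε i (A ε j) < F ε i (A ε i)) ∧
      (∀ i p, f p ≤ f a → ∀ᶠ ε in 𝓝[>] 0, F ε i p < F ε i (A ε i)) ∧
      (∀ i b, f b < f a → ∀ y : ℝ → E, Tendsto y (𝓝[>] 0) (𝓝 b) →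
        ∀ᶠ ε in 𝓝[>] 0, F ε i (y ε) < F ε i (A ε i)) := by
  obtain ⟨c, hc⟩ : ∃ c, f c = 1 := by
    obtain ⟨c, hc⟩ : ∃ c, f c ≠ 0 := by
      by_contra! h
      exact hf (ContinuousLinearMap.ext h)
    exact ⟨(f c)⁻¹ • c, by simp [hc]⟩
  obtain ⟨e, hfe, he⟩ : ∃ e, f e = 0 ∧ e ≠ 0 := by
    have h1 : LinearMap.ker f.toLinearMap ≠ ⊥ := by
      intro h
      have := LinearMap.finrank_le_finrank_of_injective (LinearMap.ker_eq_bot.1 h)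
      simp at this
      omega
    obtain ⟨e, he, he0⟩ := Submodule.exists_mem_ne_zero_of_ne_bot h1
    exact ⟨e, he, he0⟩
  obtain ⟨h, hhe, hhc⟩ : ∃ h : E →L[ℝ] ℝ, h e = 1 ∧ h c = 0 := by
    obtain ⟨h, hh⟩ := SeparatingDual.exists_eq_one (R := ℝ) he
    exact ⟨h - h c • f, by simp [hh, hfe], by simp [hc]⟩
  let A : ℝ → ℕ → E := fun ε i ↦ a + ε • (c + (ε ^ 2 * i) • e - (ε ^ 4 * i ^ 2 : ℝ) • c)
  let F : ℝ → ℕ → E →L[ℝ] ℝ := fun ε i ↦ f + (2 * ε ^ 2 * i) • h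
  have hA : Tendsto A (𝓝[>] 0) (𝓝 fun _ ↦ a) := by
    have h1 : Continuous A := by fun_prop
    have h2 : A 0 = fun _ ↦ a := by ext; simp [A]
    exact h2 ▸ h1.continuousAt.tendsto.mono_left nhdsWithin_le_nhds
  have hFA : ∀ ε i j, F ε i (A ε j) =
      F ε i a + ε * (1 - ε ^ 4 * j ^ 2 + 2 * ε ^ 4 * i * j) := by
    intro ε i j
    simp [F, A, hc, hfe, hhe, hhc]
    ring
  have hF : ∀ i b, ∀ y : ℝ → E, Tendsto y (𝓝[>] 0) (𝓝 b) →
      Tendsto (fun ε ↦ F ε i (y ε)) (𝓝[>] 0) (𝓝 (f b)) := by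
    intro i b y hy
    have h1 : Tendsto (fun ε : ℝ ↦ 2 * ε ^ 2 * i) (𝓝[>] 0) (𝓝 0) := by
      have : Continuous fun ε : ℝ ↦ 2 * ε ^ 2 * (i : ℝ) := by fun_prop
      simpa using this.continuousAt.tendsto.mono_left (nhdsWithin_le_nhds (a := 0) (s := Ioi 0))
    have h2 := ((f.continuous.tendsto b).comp hy).add (h1.mul ((h.continuous.tendsto b).comp hy))
    simpa [F, Function.comp_def] using h2
  refine ⟨A, F, hA, fun i j hij ↦ ?_, fun i p hp ↦ ?_, fun i b hb y hy ↦ ?_⟩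
  · filter_upwards [self_mem_nhdsWithin] with ε hε
    have hε : 0 < ε := hε
    have hij' : (j : ℝ) - i ≠ 0 := sub_ne_zero.2 (by exact_mod_cast hij)
    rw [hFA, hFA]
    have : 0 < ε * ε ^ 4 * ((j : ℝ) - i) ^ 2 := by positivity
    nlinarith
  · have h1 : ∀ᶠ ε : ℝ in 𝓝[>] 0, -(2 * ε * i * h (a - p)) < 1 := by
      have : Continuous fun ε : ℝ ↦ -(2 * ε * i * h (a - p)) := by fun_prop
      have h2 : Tendsto (fun ε : ℝ ↦ -(2 * ε * i * h (a - p))) (𝓝[>] 0) (𝓝 0) := by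
        simpa using this.continuousAt.tendsto.mono_left (nhdsWithin_le_nhds (a := 0) (s := Ioi 0))
      exact h2.eventually_lt_const one_pos
    filter_upwards [h1, self_mem_nhdsWithin] with ε h1 hε
    have hε : 0 < ε := hε
    rw [hFA]
    simp only [F, add_apply, smul_apply, smul_eq_mul]
    simp only [map_sub] at h1
    have h2 := mul_lt_mul_of_pos_left h1 hε
    have h3 : 0 ≤ ε * (ε ^ 4 * (i : ℝ) ^ 2) := by positivity
    nlinarith
  · have hA' : Tendsto (fun ε ↦ A ε i) (𝓝[>] 0) (𝓝 a) := (tendsto_pi_nhds.1 hA) i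
    exact (hF i b y hy).eventually_lt (hF i a _ hA') hb

end Cap

lemma continuous_pi_sumElim {X Y ι κ : Type*} [TopologicalSpace X] [TopologicalSpace Y]
    {φ : X → ι → Y} {ψ : X → κ → Y} (hφ : Continuous φ) (hψ : Continuous ψ) :
    Continuous fun x ↦ Sum.elim (φ x) (ψ x) := by
  refine continuous_pi ?_
  rintro (i | i)
  · exact (continuous_apply i).comp hφ
  · exact (continuous_apply i).comp hψ

section Configuration

variable {E : Type*} [NormedAddCommGroup E] [NormedSpace ℝ E]

lemma ExposedFamily.eventually_comp {X ι : Type*} [TopologicalSpace X] [Finite ι] {φ : X → ι → E}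
    (hφ : Continuous φ) {x : X} (hx : ExposedFamily (φ x)) :
    ∀ᶠ x' in 𝓝 x, ExposedFamily (φ x') :=
  hφ.continuousAt.eventually hx.eventually

/-- A family approaching `a` and exposed by explicit functionals, together with a family whose
limit points are strictly separated from the others and from `a`. -/
lemma eventually_exposedFamily_sumElim {κ : Type*} [Finite κ] {a : E} {A : ℝ → ℕ → E}
    {F : ℝ → ℕ → E →L[ℝ] ℝ} (hA : Tendsto A (𝓝[>] 0) (𝓝 fun _ ↦ a))
    (hAA : ∀ i j, j ≠ i → ∀ᶠ ε in 𝓝[>] 0, F ε i (A ε j) < F ε i (A ε i))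
    {y : ℝ → κ → E} {z : κ → E} (hy : Tendsto y (𝓝[>] 0) (𝓝 z))
    (hyA : ∀ i k, ∀ᶠ ε in 𝓝[>] 0, F ε i (y ε k) < F ε i (A ε i))
    (hz : ∀ k, z k ∉ convexHull ℝ (insert a (z '' {k}ᶜ))) (m : ℕ) :
    ∀ᶠ ε in 𝓝[>] 0, ExposedFamily (Sum.elim (y ε) fun i : Fin m ↦ A ε i) := by
  have hA' : ∀ i, Tendsto (fun ε ↦ A ε i) (𝓝[>] 0) (𝓝 a) := tendsto_pi_nhds.1 hA
  have hy' : ∀ k, Tendsto (fun ε ↦ y ε k) (𝓝[>] 0) (𝓝 (z k)) := tendsto_pi_nhds.1 hy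
  refine eventually_all.2 ?_
  rintro (k | i)
  · obtain ⟨G, hG⟩ := exists_forall_lt_of_notMem_convexHull
      (((Set.toFinite {k}ᶜ).image z).insert a) (hz k)
    have : ∀ᶠ ε in 𝓝[>] (0 : ℝ), ∀ j, j ≠ Sum.inl k →
        G (Sum.elim (y ε) (fun i : Fin m ↦ A ε i) j) < G (y ε k) := by
      refine eventually_all.2 ?_
      have hk := (G.continuous.tendsto _).comp (hy' k)
      rintro (j | i)
      · by_cases hj : j = k
        · simp [hj]
        have := ((G.continuous.tendsto _).comp (hy' j)).eventually_lt hk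
          (hG _ (Or.inr ⟨j, hj, rfl⟩))
        filter_upwards [this] with ε h _ using h
      · have := ((G.continuous.tendsto _).comp (hA' i)).eventually_lt hk (hG _ (Or.inl rfl))
        filter_upwards [this] with ε h _ using h
    exact this.mono fun ε h ↦ ⟨G, h⟩
  · have : ∀ᶠ ε in 𝓝[>] (0 : ℝ), ∀ j, j ≠ Sum.inr i →
        F ε i (Sum.elim (y ε) (fun i : Fin m ↦ A ε i) j) < F ε i (A ε i) := by
      refine eventually_all.2 ?_
      rintro (j | j)
      · filter_upwards [hyA i j] with ε h _ using h
      · by_cases hj : j = i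
        · simp [hj]
        filter_upwards [hAA i j fun h ↦ hj (Fin.ext h)] with ε h _ using h
    exact this.mono fun ε h ↦ ⟨F ε i, h⟩

/-- The point where a ray from an interior point leaves a compact convex set. -/
lemma exists_exit_point {K : Set E} (hK : IsCompact K) (hconv : Convex ℝ K) {x e : E}
    (hx : x ∈ interior K) (he : e ≠ 0) :
    ∃ t : ℝ, 0 < t ∧ x + t • e ∈ K ∧
      ∃ f : E →L[ℝ] ℝ, 0 < f e ∧ ∀ y ∈ K, f y ≤ f (x + t • e) := by
  have hcont : Continuous fun t : ℝ ↦ x + t • e := by fun_prop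
  let T : Set ℝ := (fun t : ℝ ↦ x + t • e) ⁻¹' K
  have hTc : IsClosed T := hK.isClosed.preimage hcont
  obtain ⟨R, hR⟩ := hK.isBounded.exists_norm_le
  have hTb : T ⊆ Metric.closedBall 0 ((R + ‖x‖) / ‖e‖) := by
    intro t ht
    rw [mem_closedBall_zero_iff, le_div_iff₀ (norm_pos_iff.2 he), ← norm_smul]
    calc ‖t • e‖ = ‖(x + t • e) - x‖ := by simp
      _ ≤ ‖x + t • e‖ + ‖x‖ := norm_sub_le _ _
      _ ≤ R + ‖x‖ := by gcongr; exact hR _ ht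
  have hT : IsCompact T := (isCompact_closedBall _ _).of_isClosed_subset hTc hTb
  have h0 : 0 ∈ T := by simpa [T] using interior_subset hx
  obtain ⟨t, htT, ht⟩ := hT.exists_isGreatest ⟨0, h0⟩
  have hnot : x + t • e ∉ interior K := by
    intro h
    have : ∀ᶠ s in 𝓝 t, x + s • e ∈ interior K :=
      hcont.continuousAt.eventually (isOpen_interior.mem_nhds h)
    obtain ⟨s, hs, hts⟩ := ((this.filter_mono nhdsWithin_le_nhds).and
      (self_mem_nhdsWithin : Ioi t ∈ 𝓝[>] t)).exists
    exact (ht (show s ∈ T from interior_subset (s := K) hs)).not_gt hts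
  obtain ⟨f, hf⟩ := geometric_hahn_banach_open_point hconv.interior isOpen_interior hnot
  have ht0 : 0 < t := by
    refine (ht h0).lt_of_ne ?_
    rintro rfl
    exact hnot (by simpa using hx)
  refine ⟨t, ht0, htT, f, ?_, fun y hy ↦ ?_⟩
  · have := hf x hx
    simp only [map_add, map_smul, smul_eq_mul, lt_add_iff_pos_right] at this
    exact pos_of_mul_pos_right this ht0.le
  · have hy' : y ∈ closure (interior K) := by
      rw [hconv.closure_interior_eq_closure_of_nonempty_interior ⟨x, hx⟩]
      exact subset_closure hy
    exact closure_minimal (fun z hz ↦ (hf z hz).le)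
      (isClosed_le f.continuous continuous_const) hy'

lemma notMem_convexHull_pair_of_notMem {L : AffineSubspace ℝ E} {a b p : E} (ha : a ∈ L)
    (hb : b ∈ L) (hp : p ∉ L) : p ∉ convexHull ℝ {a, b} := fun h ↦
  hp (affineSpan_le.2 (insert_subset ha (singleton_subset_iff.2 hb))
    (convexHull_subset_affineSpan _ h))

lemma notMem_convexHull_pair_of_ne {L : AffineSubspace ℝ E} {a b p : E} (ha : a ∈ L)
    (hb : b ∈ L) (hp : p ∉ L) (hab : a ≠ b) : b ∉ convexHull ℝ {a, p} := by
  intro h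
  rw [convexHull_pair, segment_eq_image_lineMap] at h
  obtain ⟨t, -, rfl⟩ := h
  have ht : t ≠ 0 := by
    rintro rfl
    simp at hab
  refine hp ?_
  have := AffineMap.lineMap_mem (t⁻¹) ha hb
  simpa [AffineMap.lineMap_apply, smul_smul, ht] using this

lemma affineSpan_pair_ne_top (hE : 2 ≤ Module.finrank ℝ E) (x y : E) :
    affineSpan ℝ {x, y} ≠ ⊤ := by
  intro h
  have h1 := (collinear_pair ℝ x y).finrank_le_one
  rw [← direction_affineSpan, h, AffineSubspace.direction_top, finrank_top] at h1
  omega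

variable [FiniteDimensional ℝ E]

/-- Two full-dimensional polytopes have non-vertex boundary points `a` and `b` visible from each
other's outside along a line that misses all the vertices. -/
lemma exists_boundary_points (hE : 2 ≤ Module.finrank ℝ E) {V W : Finset E}
    (hV : affineSpan ℝ (V : Set E) = ⊤) (hW : affineSpan ℝ (W : Set E) = ⊤) :
    ∃ (L : AffineSubspace ℝ E) (a b : E) (f g : E →L[ℝ] ℝ),
      a ∈ L ∧ b ∈ L ∧ (∀ v, v ∈ V ∨ v ∈ W → v ∉ L) ∧
      a ∈ convexHull ℝ (V : Set E) ∧ b ∈ convexHull ℝ (W : Set E) ∧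
      (∀ v ∈ V, f v ≤ f a) ∧ (∀ w ∈ W, g w ≤ g b) ∧ f b < f a ∧ g a < g b := by
  classical
  obtain ⟨x₁, hx₁⟩ := interior_convexHull_nonempty_iff_affineSpan_eq_top.2 hV
  obtain ⟨y₁, hy₁⟩ := interior_convexHull_nonempty_iff_affineSpan_eq_top.2 hW
  obtain ⟨x, hx, hxg⟩ := exists_mem_forall_notMem_affineSpan (V ∪ W)
    (isOpen_interior.mem_nhds hx₁)
  obtain ⟨y, hy, hyg⟩ := exists_mem_forall_notMem_affineSpan (insert x (V ∪ W))
    (isOpen_interior.mem_nhds hy₁)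
  have hxy : y - x ≠ 0 := by
    rw [sub_ne_zero]
    rintro rfl
    exact hyg {y, y} (by simp) (affineSpan_pair_ne_top hE _ _) (mem_affineSpan ℝ (by simp))
  obtain ⟨s, hs, ha, f, hfe, hf⟩ := exists_exit_point (V.finite_toSet.isCompact_convexHull ℝ)
    (convex_convexHull ℝ _) hx (neg_ne_zero.2 hxy)
  obtain ⟨t, ht, hb, g, hge, hg⟩ := exists_exit_point (W.finite_toSet.isCompact_convexHull ℝ)
    (convex_convexHull ℝ _) hy hxy
  have hxL : x ∈ affineSpan ℝ {x, y} := mem_affineSpan ℝ (by simp)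
  have hyL : y ∈ affineSpan ℝ {x, y} := mem_affineSpan ℝ (by simp)
  refine ⟨affineSpan ℝ {x, y}, _, _, f, g, ?_, ?_, fun v hv hvL ↦ ?_, ha, hb,
    fun v hv ↦ hf v (subset_convexHull ℝ _ hv), fun w hw ↦ hg w (subset_convexHull ℝ _ hw), ?_, ?_⟩
  · have := AffineMap.lineMap_mem (-s) hxL hyL
    simpa [AffineMap.lineMap_apply, add_comm, smul_sub, sub_eq_add_neg] using this
  · have := AffineMap.lineMap_mem (1 + t) hxL hyL
    convert! this using 1
    simp [AffineMap.lineMap_apply]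
    module
  · have hvx : x ≠ v := by
      rintro rfl
      exact hxg {x, x} (by simpa using hv) (affineSpan_pair_ne_top hE _ _)
        (mem_affineSpan ℝ (by simp))
    obtain ⟨r, rfl⟩ := mem_affineSpan_pair_iff_exists_lineMap_eq.1 hvL
    have hr : r ≠ 0 := by
      rintro rfl
      simp at hvx
    refine hyg {x, AffineMap.lineMap x y r} ?_ (affineSpan_pair_ne_top hE _ _) ?_
    · rintro z (rfl | rfl)
      · simp
      · exact Finset.mem_coe.2 (Finset.mem_insert_of_mem (Finset.mem_union.2 hv))
    · have := AffineMap.lineMap_mem r⁻¹ (left_mem_affineSpan_pair ℝ x (AffineMap.lineMap x y r))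
        (right_mem_affineSpan_pair ℝ x (AffineMap.lineMap x y r))
      simpa [AffineMap.lineMap_apply, smul_smul, hr] using this
  · simp only [map_neg, map_sub, map_add, map_smul, smul_eq_mul] at hfe ⊢
    nlinarith
  · simp only [map_neg, map_sub, map_add, map_smul, smul_eq_mul] at hge ⊢
    nlinarith

/-- The two auxiliary clusters of points through which one polytope is transformed into another. -/
lemma exists_clusters (hE : 2 ≤ Module.finrank ℝ E) {V W : Finset E}
    (hV : affineSpan ℝ (V : Set E) = ⊤) (hW : affineSpan ℝ (W : Set E) = ⊤)
    (hVe : (convexHull ℝ (V : Set E)).extremePoints ℝ = V)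
    (hWe : (convexHull ℝ (W : Set E)).extremePoints ℝ = W)
    {p q : E} (hp : p ∈ V) (hq : q ∈ W) (m k l : ℕ) :
    ∃ a b : ℕ → E, GenericSeq ((V : Set E) ∪ W) a ∧ GenericSeq ((V : Set E) ∪ W ∪ a '' Iio m) b ∧
      ExposedSet ((V : Set E) ∪ a '' Iio m) ∧ ExposedSet ((W : Set E) ∪ b '' Iio m) ∧
      ExposedSet (a '' Iio m ∪ b '' Iio m) ∧ ExposedSet ({p, b k} ∪ a '' Iio m) ∧
      ExposedSet ({q, a l} ∪ b '' Iio m) := by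
  classical
  obtain ⟨L, a, b, f, g, haL, hbL, hL, haV, hbW, hfV, hgW, hfab, hgab⟩ :=
    exists_boundary_points hE hV hW
  have hab : a ≠ b := by
    rintro rfl
    exact hfab.ne rfl
  obtain ⟨A, F, hA, hAA, hAf, hAf'⟩ := exists_cap hE a (f := f) (by rintro rfl; simp at hfab)
  obtain ⟨B, G, hB, hBB, hBg, hBg'⟩ := exists_cap hE b (f := g) (by rintro rfl; simp at hgab)
  have hA' : ∀ i, Tendsto (fun ε ↦ A ε i) (𝓝[>] 0) (𝓝 a) := tendsto_pi_nhds.1 hA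
  have hB' : ∀ i, Tendsto (fun ε ↦ B ε i) (𝓝[>] 0) (𝓝 b) := tendsto_pi_nhds.1 hB
  have hpL := hL p (Or.inl hp)
  have hqL := hL q (Or.inr hq)
  have image_compl : ∀ (S : Finset E) (v : S),
      (fun v : S ↦ (v : E)) '' {v}ᶜ = (S : Set E) \ {v.1} := by
    intro S v
    ext z
    constructor
    · rintro ⟨w, hw, rfl⟩
      exact ⟨w.2, fun h ↦ hw (Subtype.ext h)⟩
    · rintro ⟨hz, hzv⟩
      exact ⟨⟨z, hz⟩, fun h ↦ hzv (congrArg Subtype.val h), rfl⟩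
  have h1 := eventually_exposedFamily_sumElim hA hAA (κ := V) (y := fun _ v ↦ v) (z := fun v ↦ v)
    tendsto_const_nhds (fun i v ↦ hAf i v (hfV v v.2)) (fun v ↦ by
      rw [image_compl]
      exact notMem_convexHull_insert_diff hVe haV v.2
        fun h ↦ hL v (Or.inl v.2) (h ▸ haL)) m
  have h2 := eventually_exposedFamily_sumElim hB hBB (κ := W) (y := fun _ v ↦ v) (z := fun v ↦ v)
    tendsto_const_nhds (fun i v ↦ hBg i v (hgW v v.2)) (fun v ↦ by
      rw [image_compl]
      exact notMem_convexHull_insert_diff hWe hbW v.2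
        fun h ↦ hL v (Or.inr v.2) (h ▸ hbL)) m
  have h3 : ∀ᶠ ε in 𝓝[>] 0, ExposedFamily
      (Sum.elim (fun i : Fin m ↦ A ε i) fun i : Fin m ↦ B ε i) := by
    refine eventually_all.2 ?_
    rintro (i | i)
    · have : ∀ᶠ ε in 𝓝[>] (0 : ℝ), ∀ j, j ≠ Sum.inl i →
          F ε i (Sum.elim (fun i : Fin m ↦ A ε i) (fun i : Fin m ↦ B ε i) j) <
            F ε i (A ε i) := by
        refine eventually_all.2 ?_
        rintro (j | j)
        · by_cases hj : j = i
          · simp [hj]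
          filter_upwards [hAA i j fun h ↦ hj (Fin.ext h)] with ε h _ using h
        · filter_upwards [hAf' i b hfab _ (hB' j)] with ε h _ using h
      exact this.mono fun ε h ↦ ⟨F ε i, h⟩
    · have : ∀ᶠ ε in 𝓝[>] (0 : ℝ), ∀ j, j ≠ Sum.inr i →
          G ε i (Sum.elim (fun i : Fin m ↦ A ε i) (fun i : Fin m ↦ B ε i) j) <
            G ε i (B ε i) := by
        refine eventually_all.2 ?_
        rintro (j | j)
        · filter_upwards [hBg' i a hgab _ (hA' j)] with ε h _ using h
        · by_cases hj : j = i
          · simp [hj]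
          filter_upwards [hBB i j fun h ↦ hj (Fin.ext h)] with ε h _ using h
      exact this.mono fun ε h ↦ ⟨G ε i, h⟩
  have compl_zero : ({0}ᶜ : Set (Fin 2)) = {1} := by ext i; fin_cases i <;> simp
  have compl_one : ({1}ᶜ : Set (Fin 2)) = {0} := by ext i; fin_cases i <;> simp
  have h4 := eventually_exposedFamily_sumElim hA hAA (κ := Fin 2) (y := fun ε ↦ ![p, B ε k])
    (z := ![p, b]) (tendsto_pi_nhds.2 fun i ↦ by
      fin_cases i
      · exact tendsto_const_nhds
      · exact hB' k)
    (fun i j ↦ by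
      fin_cases j
      · exact hAf i p (hfV p hp)
      · exact hAf' i b hfab _ (hB' k))
    (fun i ↦ by
      fin_cases i
      · simpa [compl_zero] using notMem_convexHull_pair_of_notMem haL hbL hpL
      · simpa [compl_one] using notMem_convexHull_pair_of_ne haL hbL hpL hab) m
  have h5 := eventually_exposedFamily_sumElim hB hBB (κ := Fin 2) (y := fun ε ↦ ![q, A ε l])
    (z := ![q, a]) (tendsto_pi_nhds.2 fun i ↦ by
      fin_cases i
      · exact tendsto_const_nhds
      · exact hA' l)
    (fun i j ↦ by
      fin_cases j
      · exact hBg i q (hgW q hq)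
      · exact hBg' i a hgab _ (hA' l))
    (fun i ↦ by
      fin_cases i
      · simpa [compl_zero] using notMem_convexHull_pair_of_notMem hbL haL hqL
      · simpa [compl_one] using notMem_convexHull_pair_of_ne hbL haL hqL hab.symm) m
  obtain ⟨ε, h1, h2, h3, h4, h5⟩ := (h1.and (h2.and (h3.and (h4.and h5)))).exists
  have hpair : ∀ {φ ψ : (ℕ → E) × (ℕ → E) → E}, Continuous φ → Continuous ψ →
      Continuous fun x ↦ ![φ x, ψ x] := by
    intro φ ψ hφ hψ
    refine continuous_pi fun i ↦ ?_
    fin_cases i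
    · exact hφ
    · exact hψ
  have hfst : Continuous fun (x : (ℕ → E) × (ℕ → E)) (i : Fin m) ↦ x.1 i := by fun_prop
  have hsnd : Continuous fun (x : (ℕ → E) × (ℕ → E)) (i : Fin m) ↦ x.2 i := by fun_prop
  have e1 := ExposedFamily.eventually_comp (x := (A ε, B ε))
    (continuous_pi_sumElim continuous_const hfst) h1
  have e2 := ExposedFamily.eventually_comp (x := (A ε, B ε))
    (continuous_pi_sumElim continuous_const hsnd) h2
  have e3 := ExposedFamily.eventually_comp (x := (A ε, B ε))
    (continuous_pi_sumElim hfst hsnd) h3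
  have e4 := ExposedFamily.eventually_comp (x := (A ε, B ε)) (φ := fun x ↦
    Sum.elim ![p, x.2 k] fun i : Fin m ↦ x.1 i)
    (continuous_pi_sumElim (hpair
      (φ := fun _ ↦ p) (ψ := fun x ↦ x.2 k) (by fun_prop) (by fun_prop)) hfst) h4
  have e5 := ExposedFamily.eventually_comp (x := (A ε, B ε)) (φ := fun x ↦
    Sum.elim ![q, x.1 l] fun i : Fin m ↦ x.2 i)
    (continuous_pi_sumElim (hpair
      (φ := fun _ ↦ q) (ψ := fun x ↦ x.1 l) (by fun_prop) (by fun_prop)) hsnd) h5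
  obtain ⟨U₁, hU₁, U₂, hU₂, hU⟩ := mem_nhds_prod_iff.1 (e1.and (e2.and (e3.and (e4.and e5))))
  obtain ⟨a', ha', hga⟩ := exists_genericSeq (V ∪ W) hU₁
  obtain ⟨b', hb', hgb⟩ := exists_genericSeq (V ∪ W ∪ (Finset.range m).image a') hU₂
  obtain ⟨h1, h2, h3, h4, h5⟩ := hU (mk_mem_prod ha' hb')
  have range_fin : ∀ x : ℕ → E, range (fun i : Fin m ↦ x i) = x '' Iio m := by
    intro x
    ext z
    simp [Fin.exists_iff]
  have range_coe : ∀ S : Finset E, range (fun v : S ↦ (v : E)) = S := fun S ↦ Subtype.range_coe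
  refine ⟨a', b', by simpa using hga, ?_, ?_, ?_, ?_, ?_, ?_⟩
  · have : ((V ∪ W ∪ (Finset.range m).image a' : Finset E) : Set E) =
        (V : Set E) ∪ W ∪ a' '' Iio m := by
      simp [Set.ext_iff, or_assoc]
    rwa [this] at hgb
  · simpa only [Sum.elim_range, range_fin, range_coe] using h1.exposedSet_range
  · simpa only [Sum.elim_range, range_fin, range_coe] using h2.exposedSet_range
  · simpa only [Sum.elim_range, range_fin] using h3.exposedSet_range
  · simpa only [Sum.elim_range, range_fin, Matrix.range_cons, Matrix.range_empty, union_empty,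
      singleton_union] using h4.exposedSet_range
  · simpa only [Sum.elim_range, range_fin, Matrix.range_cons, Matrix.range_empty, union_empty,
      singleton_union] using h5.exposedSet_range

end Configuration

section Generic

variable {E : Type*} [NormedAddCommGroup E] [NormedSpace ℝ E]

lemma GenericSeq.mono {F G : Set E} {x : ℕ → E} (hx : GenericSeq G x) (h : F ⊆ G) :
    GenericSeq F x := fun k S hS ↦ hx k S (hS.trans (union_subset_union_left _ h))

lemma GenericSeq.shift {F : Set E} {x : ℕ → E} (hx : GenericSeq F x) (j : ℕ) :
    GenericSeq (F ∪ x '' Iio j) fun i ↦ x (i + j) := by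
  intro k S hS
  refine hx (k + j) S (hS.trans ?_)
  rintro _ ((h | ⟨i, hi, rfl⟩) | ⟨i, hi, rfl⟩)
  · exact Or.inl h
  · exact Or.inr ⟨i, by simp only [mem_Iio] at hi ⊢; omega, rfl⟩
  · exact Or.inr ⟨i + j, by simpa using hi, rfl⟩

lemma GenericSeq.notMem (hE : 2 ≤ Module.finrank ℝ E) {F : Set E} {x : ℕ → E}
    (hx : GenericSeq F x) (k : ℕ) : x k ∉ F ∪ x '' Iio k := fun h ↦
  hx k {x k, x k} (by simpa using h) (affineSpan_pair_ne_top hE _ _) (mem_affineSpan ℝ (by simp))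

lemma GenericSeq.notMem_image (hE : 2 ≤ Module.finrank ℝ E) {F : Set E} {x : ℕ → E}
    (hx : GenericSeq F x) {v : E} (hv : v ∈ F) (s : Set ℕ) : v ∉ x '' s := by
  rintro ⟨i, -, rfl⟩
  exact hx.notMem hE i (Or.inl hv)

lemma exposedSet_of_extremePoints_convexHull {V : Set E} (hfin : V.Finite)
    (hV : (convexHull ℝ V).extremePoints ℝ = V) : ExposedSet V := by
  intro v hv
  have hv' : v ∉ convexHull ℝ (V \ {v}) := by
    intro h
    have h1 : convexHull ℝ (V \ {v}) = convexHull ℝ V := by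
      refine (convexHull_mono sdiff_subset).antisymm (convexHull_min (fun w hw ↦ ?_)
        (convex_convexHull ℝ _))
      by_cases hwv : w = v
      · exact hwv ▸ h
      · exact subset_convexHull ℝ _ ⟨hw, hwv⟩
    have h2 : V ⊆ V \ {v} := by
      conv_lhs => rw [← hV, ← h1]
      exact extremePoints_convexHull_subset
    exact (h2 hv).2 rfl
  obtain ⟨F, hF⟩ := exists_forall_lt_of_notMem_convexHull (hfin.subset sdiff_subset) hv'
  exact ⟨F, fun y hy hyv ↦ hF y ⟨hy, hyv⟩⟩

/-- `T` is the vertex set of a full-dimensional polytope with `n` vertices. -/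
structure IsVertexSet (n : ℕ) (T : Set E) : Prop where
  finite : T.Finite
  exposed : ExposedSet T
  span : affineSpan ℝ T = ⊤
  ncard : T.ncard = n

lemma exists_affineSpan_diff_singleton_eq_top [FiniteDimensional ℝ E] {T : Set E}
    (hT : affineSpan ℝ T = ⊤) (hcard : Module.finrank ℝ E + 1 < T.ncard) :
    ∃ v ∈ T, affineSpan ℝ (T \ {v}) = ⊤ := by
  obtain ⟨t, htT, ht, hind⟩ := exists_affineIndependent ℝ E T
  have hfin : T.Finite := finite_of_ncard_pos (by omega)
  have : Fintype t := (hfin.subset htT).fintype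
  have hne : t ≠ T := by
    rintro rfl
    have h := hind.affineSpan_eq_top_iff_card_eq_finrank_add_one.1 (by simpa using hT)
    rw [← Nat.card_eq_fintype_card, Nat.card_coe_set_eq] at h
    omega
  obtain ⟨v, hv, hvt⟩ := exists_of_ssubset (htT.ssubset_of_ne hne)
  refine ⟨v, hv, top_unique ?_⟩
  rw [← hT, ← ht]
  exact affineSpan_mono ℝ fun w hw ↦ ⟨htT hw, fun h ↦ hvt (h ▸ hw)⟩

end Generic

section Paths

variable {d n : ℕ} {C : Set (Set (Pt d))}

lemma Move.symm {P Q : Set (Pt d)} (h : Move d P Q) : Move d Q P := by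
  rcases h with h | h | h | h
  · exact Or.inr (Or.inr (Or.inl h))
  · exact Or.inr (Or.inr (Or.inr h))
  · exact Or.inl h
  · exact Or.inr (Or.inl h)

lemma PathLE.refl {P : Set (Pt d)} (hP : P ∈ C) : PathLE d C P P 0 :=
  ⟨0, fun _ ↦ P, le_rfl, rfl, rfl, fun _ _ ↦ hP, fun _ h ↦ absurd h (Nat.not_lt_zero _)⟩

lemma PathLE.of_move {P Q : Set (Pt d)} (hP : P ∈ C) (hQ : Q ∈ C) (h : Move d P Q) :
    PathLE d C P Q 1 := by
  refine ⟨1, fun i ↦ if i = 0 then P else Q, le_rfl, rfl, rfl, fun i _ ↦ ?_, fun i hi ↦ ?_⟩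
  · dsimp only
    split_ifs <;> assumption
  · obtain rfl : i = 0 := by omega
    exact h

lemma PathLE.mono {P Q : Set (Pt d)} {k l : ℕ} (h : PathLE d C P Q k) (hkl : k ≤ l) :
    PathLE d C P Q l :=
  let ⟨m, f, hm, hf⟩ := h
  ⟨m, f, hm.trans hkl, hf⟩

lemma PathLE.symm {P Q : Set (Pt d)} {k : ℕ} (h : PathLE d C P Q k) : PathLE d C Q P k := by
  obtain ⟨m, f, hm, h0, h1, hC, hf⟩ := h
  refine ⟨m, fun i ↦ f (m - i), hm, by simpa using h1, by simpa using h0,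
    fun i _ ↦ hC _ (Nat.sub_le _ _), fun i hi ↦ ?_⟩
  have h := (hf (m - (i + 1)) (by omega)).symm
  rwa [show m - (i + 1) + 1 = m - i by omega] at h

lemma PathLE.trans {P Q R : Set (Pt d)} {k l : ℕ} (h : PathLE d C P Q k)
    (h' : PathLE d C Q R l) : PathLE d C P R (k + l) := by
  obtain ⟨m, f, hm, h0, h1, hC, hf⟩ := h
  obtain ⟨m', f', hm', h0', h1', hC', hf'⟩ := h'
  refine ⟨m + m', fun i ↦ if i ≤ m then f i else f' (i - m), by omega, by simpa using h0, ?_,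
    fun i hi ↦ ?_, fun i hi ↦ ?_⟩
  · rcases Nat.eq_zero_or_pos m' with rfl | hpos
    · simp [h1, ← h0', h1']
    · simp [show ¬ m' = 0 by omega, h1']
  · dsimp only
    split_ifs with h
    · exact hC i h
    · exact hC' _ (by omega)
  · dsimp only
    rcases lt_trichotomy i m with h | rfl | h
    · rw [if_pos h.le, if_pos (by omega)]
      exact hf i h
    · rw [if_pos le_rfl, if_neg (by omega), Nat.add_sub_cancel_left, h1, ← h0']
      exact hf' 0 (by omega)
    · rw [if_neg (by omega), if_neg (by omega), show i + 1 - m = i - m + 1 by omega]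
      exact hf' _ (by omega)

lemma IsVertexSet.mem_NClass {T : Set (Pt d)} {k : ℕ} (hT : IsVertexSet k T)
    (hk : k = n ∨ k = n + 1) : convexHull ℝ T ∈ NClass d n := by
  refine ⟨⟨⟨hT.finite.toFinset, by simp⟩, ?_⟩, ?_⟩
  · rw [FullDim, affineSpan_convexHull, hT.span]
  · rwa [nVerts, hT.exposed.extremePoints_convexHull hT.finite, hT.ncard]

lemma exists_isVertexSet {P : Set (Pt d)} (hP : P ∈ Gamma d) :
    ∃ V : Set (Pt d), IsVertexSet (nVerts d P) V ∧ P = convexHull ℝ V := by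
  obtain ⟨⟨S, rfl⟩, hdim⟩ := hP
  have hconv := convexHull_extremePoints_convexHull S.finite_toSet
  have hfin := S.finite_toSet.subset (extremePoints_convexHull_subset (𝕜 := ℝ))
  refine ⟨_, ⟨hfin, exposedSet_of_extremePoints_convexHull hfin (by rw [hconv]), ?_, rfl⟩,
    hconv.symm⟩
  rwa [← affineSpan_convexHull, hconv]

lemma insertMove_of_exposedSet {S : Set (Pt d)} {x : Pt d} (hfin : S.Finite)
    (hS : ExposedSet (insert x S)) :
    InsertMove d (convexHull ℝ S) (convexHull ℝ (insert x S)) := by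
  have h : convexHull ℝ (convexHull ℝ S ∪ {x}) = convexHull ℝ (insert x S) := by
    rw [convexHull_convexHull_union_left, union_singleton]
  refine ⟨x, ?_, h.symm⟩
  rw [CanInsert, h, hS.extremePoints_convexHull (hfin.insert x),
    (hS.mono (subset_insert x S)).extremePoints_convexHull hfin, union_singleton]

lemma IsVertexSet.pathLE_insert {S : Set (Pt d)} {x : Pt d} (hS : IsVertexSet n S) (hx : x ∉ S)
    (h : ExposedSet (insert x S)) :
    PathLE d (NClass d n) (convexHull ℝ S) (convexHull ℝ (insert x S)) 1 := by
  have hU : IsVertexSet (n + 1) (insert x S) := ⟨hS.finite.insert x, h,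
    top_unique (hS.span ▸ affineSpan_mono ℝ (subset_insert x S)), by
      rw [ncard_insert_of_notMem hx hS.finite, hS.ncard]⟩
  exact .of_move (hS.mem_NClass (.inl rfl)) (hU.mem_NClass (.inr rfl))
    (.inl (insertMove_of_exposedSet hS.finite h))

lemma IsVertexSet.pathLE_exchange {S : Set (Pt d)} {x y : Pt d}
    (hy : IsVertexSet n (insert y S)) (hx : IsVertexSet n (insert x S)) (hxS : x ∉ insert y S)
    (hyS : y ∉ insert x S) (h : ExposedSet (insert x (insert y S))) :
    PathLE d (NClass d n) (convexHull ℝ (insert y S)) (convexHull ℝ (insert x S)) 2 := by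
  have h' := hx.pathLE_insert hyS (insert_comm x y S ▸ h)
  rw [insert_comm] at h'
  exact (hy.pathLE_insert hxS h).trans h'.symm

/-- Points of a vertex set outside `K` can be replaced one by one with points of a generic
sequence. -/
lemma IsVertexSet.replace (hd : 2 ≤ d) {V K : Set (Pt d)} {x : ℕ → Pt d} {m : ℕ}
    (hV : IsVertexSet n V) (hK : K ⊆ V) (hm : K.ncard + m = n) (hx : GenericSeq V x)
    (hexp : ExposedSet (V ∪ x '' Iio m)) :
    IsVertexSet n (K ∪ x '' Iio m) ∧
      PathLE d (NClass d n) (convexHull ℝ V) (convexHull ℝ (K ∪ x '' Iio m)) (2 * m) := by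
  have hE : 2 ≤ Module.finrank ℝ (Pt d) := by simpa using hd
  suffices ∀ k ≤ m, ∃ R ⊆ V, K ⊆ R ∧ R.ncard + k = n ∧ IsVertexSet n (R ∪ x '' Iio k) ∧
      PathLE d (NClass d n) (convexHull ℝ V) (convexHull ℝ (R ∪ x '' Iio k)) (2 * k) by
    obtain ⟨R, hRV, hKR, hR, h⟩ := this m le_rfl
    rwa [eq_of_subset_of_ncard_le hKR (by omega) (hV.finite.subset hRV)]
  intro k
  induction k with
  | zero =>
    refine fun _ ↦ ⟨V, Subset.rfl, hK, hV.ncard, ?_⟩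
    simpa using ⟨hV, PathLE.refl (hV.mem_NClass (.inl rfl))⟩
  | succ k ih =>
    intro hk
    obtain ⟨R, hRV, hKR, hR, hC, hpath⟩ := ih (by omega)
    have hRfin := hV.finite.subset hRV
    obtain ⟨v, hvR, hvK⟩ := exists_mem_notMem_of_ncard_lt_ncard (s := K) (t := R) (by omega)
      (hRfin.subset hKR)
    have hxk := hx.notMem hE k
    have hvx := hx.notMem_image hE (hRV hvR)
    let D : Set (Pt d) := R \ {v} ∪ x '' Iio k
    have hvD : v ∉ D := by
      rintro (h | h)
      · exact h.2 rfl
      · exact hvx _ h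
    have hDV : D ⊆ V ∪ x '' Iio k := union_subset_union_left _ (sdiff_subset.trans hRV)
    have hxD : x k ∉ D := fun h ↦ hxk (hDV h)
    have hCD : R ∪ x '' Iio k = insert v D := by
      rw [← insert_union, insert_sdiff_singleton, insert_eq_of_mem hvR]
    have hN : R \ {v} ∪ x '' Iio (k + 1) = insert (x k) D := by
      rw [show Iio (k + 1) = insert k (Iio k) by ext; simp, image_insert_eq, union_insert]
    rw [hCD] at hC hpath
    have hxv : x k ≠ v := fun h ↦ hxk (Or.inl (h ▸ hRV hvR))
    have hDfin := hC.finite.subset (subset_insert v D)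
    have hU : ExposedSet (insert (x k) (insert v D)) := by
      refine hexp.mono (insert_subset (Or.inr ⟨k, hk, rfl⟩) (insert_subset (Or.inl (hRV hvR)) ?_))
      exact hDV.trans (union_subset_union_right _ (image_mono (Iio_subset_Iio (by omega))))
    have hspan : affineSpan ℝ (insert (x k) D) = ⊤ := by
      by_cases h : affineSpan ℝ D = ⊤
      · exact top_unique (h ▸ affineSpan_mono ℝ (subset_insert _ D))
      · exact affineSpan_insert_eq_top_of_notMem hC.span (hx k D hDV h)
    have hcard : (insert (x k) D).ncard = n := by
      rw [← hC.ncard, ncard_insert_of_notMem hxD hDfin, ncard_insert_of_notMem hvD hDfin]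
    have hNew : IsVertexSet n (insert (x k) D) :=
      ⟨hDfin.insert _, hU.mono (insert_subset_insert (subset_insert v D)), hspan, hcard⟩
    refine ⟨R \ {v}, sdiff_subset.trans hRV, subset_sdiff_singleton hKR hvK, ?_, ?_⟩
    · have := ncard_sdiff_singleton_add_one hvR hRfin
      omega
    · rw [hN]
      exact ⟨hNew, hpath.trans (hC.pathLE_exchange hNew (by simp [hxv, hxD])
        (by simp [hxv.symm, hvD]) hU)⟩

lemma IsVertexSet.pathLE (hd : 2 ≤ d) (hn : 3 ≤ n) {V W : Set (Pt d)} (hV : IsVertexSet n V)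
    (hW : IsVertexSet n W) :
    PathLE d (NClass d n) (convexHull ℝ V) (convexHull ℝ W) (6 * n - 4) := by
  have hE : 2 ≤ Module.finrank ℝ (Pt d) := by simpa using hd
  obtain ⟨p, hp⟩ : V.Nonempty := nonempty_of_ncard_ne_zero (by rw [hV.ncard]; omega)
  obtain ⟨q, hq⟩ : W.Nonempty := nonempty_of_ncard_ne_zero (by rw [hW.ncard]; omega)
  obtain ⟨m, rfl⟩ : ∃ m, n = m + 2 := ⟨n - 2, by omega⟩
  obtain ⟨a, b, ha, hb, hVa, hWb, hab, hpa, hqb⟩ := exists_clusters hE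
    (V := hV.finite.toFinset) (W := hW.finite.toFinset) (by simpa using hV.span)
    (by simpa using hW.span) (by simpa using hV.exposed.extremePoints_convexHull hV.finite)
    (by simpa using hW.exposed.extremePoints_convexHull hW.finite) (p := p) (q := q)
    (by simpa using hp) (by simpa using hq) (m + 1) 0 m
  simp only [Finite.coe_toFinset] at ha hb hVa hWb
  set A := a '' Iio (m + 1)
  set B := b '' Iio (m + 1)
  obtain ⟨hpA, path₁⟩ := hV.replace hd (K := {p}) (m := m + 1) (singleton_subset_iff.2 hp)
    (by simp; omega) (ha.mono subset_union_left) hVa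
  obtain ⟨hqB, path₅⟩ := hW.replace hd (K := {q}) (m := m + 1) (singleton_subset_iff.2 hq)
    (by simp; omega) (hb.mono (subset_union_right.trans subset_union_left)) hWb
  have hA : A.ncard = m + 1 := by
    have h : ({p} ∪ A).ncard = m + 2 := hpA.ncard
    have hpA' : p ∉ A := ha.notMem_image hE (Or.inl hp) _
    rw [singleton_union, ncard_insert_of_notMem hpA' ((finite_Iio _).image a)] at h
    omega
  have hpAV : {p} ∪ A ⊆ V ∪ W ∪ A :=
    union_subset_union_left _ (singleton_subset_iff.2 (Or.inl hp))
  have hbA := hb.mono hpAV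
  obtain ⟨hAb, path₂⟩ := hpA.replace hd (K := A) (m := 1) subset_union_right (by omega) hbA
    (hpa.mono (by
      rintro z ((rfl | hz) | ⟨i, hi, rfl⟩)
      · simp
      · exact Or.inr hz
      · obtain rfl : i = 0 := by simpa using hi
        simp))
  have hamA : a m ∈ A := ⟨m, by simp, rfl⟩
  have hamb : ∀ s, a m ∉ b '' s := hb.notMem_image hE (Or.inr hamA)
  have hshift : b '' Iio 1 ∪ (fun i ↦ b (i + 1)) '' Iio m = B := by
    ext z
    constructor
    · rintro (⟨i, hi, rfl⟩ | ⟨i, hi, rfl⟩)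
      · exact ⟨i, by simp only [mem_Iio] at hi ⊢; omega, rfl⟩
      · exact ⟨i + 1, by simpa using hi, rfl⟩
    · rintro ⟨_ | i, hi, rfl⟩
      · exact Or.inl ⟨0, by simp, rfl⟩
      · exact Or.inr ⟨i, by simpa using hi, rfl⟩
  have hK : (insert (a m) (b '' Iio 1)).ncard = 2 := by
    rw [ncard_insert_of_notMem (hamb _) ((finite_Iio _).image b)]
    simp [← Set.Iio_def]
  obtain ⟨haB, path₃⟩ := hAb.replace hd (K := insert (a m) (b '' Iio 1)) (m := m)
    (insert_subset (Or.inl hamA) subset_union_right) (by omega)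
    ((hb.mono subset_union_right).shift 1) (by rwa [union_assoc, hshift])
  rw [insert_union, hshift] at haB path₃
  rw [singleton_union] at hqB path₅
  have hamq : a m ≠ q := fun h ↦ ha.notMem hE m (Or.inl (Or.inr (h ▸ hq)))
  have haB' : a m ∉ B := hamb _
  have hqB' : q ∉ B := hb.notMem_image hE (Or.inl (Or.inr hq)) _
  have path₄ := haB.pathLE_exchange hqB (by simp [hamq.symm, hqB']) (by simp [hamq, haB'])
    (by simpa [insert_union] using hqb)
  exact ((((path₁.trans path₂).trans path₃).trans path₄).trans path₅.symm).mono (by omega)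

lemma exists_pathLE_isVertexSet (hn : d + 1 ≤ n) {P : Set (Pt d)} (hP : P ∈ NClass d n) :
    ∃ V : Set (Pt d), IsVertexSet n V ∧ PathLE d (NClass d n) P (convexHull ℝ V) 1 := by
  obtain ⟨V, hV, rfl⟩ := exists_isVertexSet hP.1
  rcases hP.2 with h | h <;> rw [h] at hV
  · exact ⟨V, hV, (PathLE.refl hP).mono zero_le_one⟩
  · obtain ⟨v, hv, hspan⟩ := exists_affineSpan_diff_singleton_eq_top hV.span
      (by rw [hV.ncard]; simpa using Nat.lt_of_succ_le (by omega))
    have hT : IsVertexSet n (V \ {v}) := ⟨hV.finite.subset sdiff_subset,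
      hV.exposed.mono sdiff_subset, hspan, by
        have := ncard_sdiff_singleton_add_one hv hV.finite
        have := hV.ncard
        omega⟩
    have hins : insert v (V \ {v}) = V := by rw [insert_sdiff_singleton, insert_eq_of_mem hv]
    have path := hT.pathLE_insert (x := v) (by simp) (by rw [hins]; exact hV.exposed)
    rw [hins] at path
    exact ⟨_, hT, path.symm⟩

end Paths

/-- the subgraph of `Γ(d)` induced by the polytopes with `n` or `n+1`
vertices is connected, has diameter at most `6n - 2`, and any two polytopes with
exactly `n` vertices are at distance at most `6n - 4` in it. -/
theorem stmt_0 (d n : ℕ) (hd : 2 ≤ d) (hn : d + 1 ≤ n) :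
    ConnectedIn d (NClass d n) ∧
    (∀ P ∈ NClass d n, ∀ Q ∈ NClass d n, PathLE d (NClass d n) P Q (6 * n - 2)) ∧
    (∀ P ∈ NClass d n, ∀ Q ∈ NClass d n, nVerts d P = n → nVerts d Q = n →
      PathLE d (NClass d n) P Q (6 * n - 4)) := by
  have hdiam : ∀ P ∈ NClass d n, ∀ Q ∈ NClass d n, PathLE d (NClass d n) P Q (6 * n - 2) := by
    intro P hP Q hQ
    obtain ⟨V, hV, hPV⟩ := exists_pathLE_isVertexSet hn hP
    obtain ⟨W, hW, hQW⟩ := exists_pathLE_isVertexSet hn hQ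
    exact ((hPV.trans (hV.pathLE hd (by omega) hW)).trans hQW.symm).mono (by omega)
  refine ⟨fun P hP Q hQ ↦ ⟨_, hdiam P hP Q hQ⟩, hdiam, fun P hP Q hQ hPn hQn ↦ ?_⟩
  obtain ⟨V, hV, rfl⟩ := exists_isVertexSet hP.1
  obtain ⟨W, hW, rfl⟩ := exists_isVertexSet hQ.1
  rw [hPn] at hV
  rw [hQn] at hW
  exact hV.pathLE hd (by omega) hW
end

section
/- For any integer n ≥ d+1, the subgraph of Γ(d) induced by the d-dimensional polytopes with n or n+1 vertices has diameter at least 4n−2d; that is, there exist two d-dimensional polytopes contained in ℝ^d, each with n or n+1 vertices, that cannot be joined within this subgraph by a path of fewer than 4n−2d edges. -/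
open Set

open scoped Finset in
/-- A sequence of finite sets of size `n` or `n + 1` changing by one element at a time, from `A` to
a disjoint set `B`, is long if the first set that meets a given nonempty subset `K` of `B` has at
most `d + 2` elements in `A ∪ B`. -/
lemma le_length_of_first_meeting {α : Type*} [DecidableEq α] {n d m : ℕ} {V : ℕ → Finset α}
    {A B K : Finset α} (hA : #A = n + 1) (hB : #B = n + 1) (hAB : Disjoint A B)
    (hK : K ⊆ B) (hKne : K.Nonempty) (h0 : V 0 = A) (hm : V m = B)
    (hV : ∀ i ≤ m, #(V i) = n ∨ #(V i) = n + 1)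
    (hstep : ∀ i < m, ∃ v, V (i + 1) = insert v (V i) ∨ V i = insert v (V (i + 1)))
    (hcross : ∀ i ≤ m, #(V i ∩ K) = 1 → #(V i ∩ A) + #(V i ∩ B) ≤ d + 2) :
    4 * n - 2 * d ≤ m := by
  have hdist : ∀ i j, i ≤ j → j ≤ m → #(symmDiff (V i) (V j)) ≤ j - i := by
    intro i j hij
    induction j, hij using Nat.le_induction with
    | base => simp
    | succ j hij ih =>
      intro hj
      have h1 := ih (by omega)
      have h2 : #(symmDiff (V j) (V (j + 1))) ≤ 1 := by
        obtain ⟨v, hv⟩ := hstep j (by omega)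
        refine (Finset.card_le_card (t := {v}) ?_).trans (Finset.card_singleton v).le
        intro x
        rcases hv with hv | hv <;> rw [hv] <;> simp only [Finset.mem_symmDiff, Finset.mem_insert, Finset.mem_singleton]
          <;> tauto
      have h3 : #(symmDiff (V i) (V (j + 1))) ≤
          #(symmDiff (V i) (V j)) + #(symmDiff (V j) (V (j + 1))) :=
        (Finset.card_le_card (symmDiff_triangle (V i) (V j) (V (j + 1)))).trans (Finset.card_union_le _ _)
      omega
  have hcard : ∀ S T : Finset α, #(symmDiff S T) + 2 * #(S ∩ T) = #S + #T := by
    intro S T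
    have h1 : #(symmDiff S T) = #(S \ T) + #(T \ S) :=
      Finset.card_union_of_disjoint disjoint_sdiff_sdiff
    have h2 := Finset.card_sdiff_add_card_inter S T
    have h3 := Finset.card_sdiff_add_card_inter T S
    rw [Finset.inter_comm T S] at h3
    omega
  have hex : ∃ i, (V i ∩ K).Nonempty := ⟨m, by rwa [hm, Finset.inter_eq_right.mpr hK]⟩
  classical
  obtain ⟨i, hi, hmin⟩ : ∃ i, (V i ∩ K).Nonempty ∧ ∀ j < i, ¬ (V j ∩ K).Nonempty :=
    ⟨Nat.find hex, Nat.find_spec hex, fun j => Nat.find_min hex⟩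
  have him : i ≤ m := by
    by_contra h
    exact hmin m (by omega) (by rwa [hm, Finset.inter_eq_right.mpr hK])
  obtain ⟨j, rfl⟩ : ∃ j, i = j + 1 := by
    refine ⟨i - 1, ?_⟩
    rcases i with _ | i
    · obtain ⟨x, hx⟩ := hi
      rw [h0, Finset.mem_inter] at hx
      exact (Finset.disjoint_left.mp hAB hx.1 (hK hx.2)).elim
    · omega
  have hj := Finset.not_nonempty_iff_eq_empty.mp (hmin j (by omega))
  have hj' : ∀ x ∈ V j, x ∉ K := fun x hx hxK => by
    have : x ∈ V j ∩ K := Finset.mem_inter.mpr ⟨hx, hxK⟩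
    simp [hj] at this
  obtain ⟨x, hx⟩ := hi
  rw [Finset.mem_inter] at hx
  obtain ⟨v, hv | hv⟩ := hstep j (by omega)
  · have hxv : x = v := by
      rw [hv, Finset.mem_insert] at hx
      exact hx.1.resolve_right fun h => hj' x h hx.2
    subst hxv
    have hxV : x ∉ V j := fun h => hj' x h hx.2
    have hc : #(V (j + 1)) = n + 1 := by
      have h1 := hV (j + 1) him
      have h2 := hV j (by omega)
      rw [hv, Finset.card_insert_of_notMem hxV] at h1 ⊢
      omega
    have h1 : #(V (j + 1) ∩ K) = 1 := by
      rw [hv, Finset.insert_inter_of_mem hx.2, hj]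
      simp
    have h2 := hcross _ him h1
    have h3 := hdist 0 (j + 1) (by omega) him
    have h4 := hdist (j + 1) m him le_rfl
    have h5 := hcard (V 0) (V (j + 1))
    have h6 := hcard (V (j + 1)) (V m)
    rw [Finset.inter_comm, h0] at h5
    rw [hm] at h6
    rw [h0] at h3
    rw [hm] at h4
    omega
  · exact (hj' x (by rw [hv]; exact Finset.mem_insert_of_mem hx.1) hx.2).elim

/-- Moves between convex sets change the vertex set by at most one element. -/
lemma Move.extremePoints_eq_insert {d : ℕ} {P Q : Set (Pt d)} (hP : Convex ℝ P) (hQ : Convex ℝ Q)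
    (h : Move d P Q) : ∃ v, extremePoints ℝ Q = insert v (extremePoints ℝ P) ∨
      extremePoints ℝ P = insert v (extremePoints ℝ Q) := by
  have hins : ∀ {P Q : Set (Pt d)}, InsertMove d P Q →
      ∃ v, extremePoints ℝ Q = insert v (extremePoints ℝ P) := by
    rintro P Q ⟨x, hx, rfl⟩
    refine ⟨x, ?_⟩
    rw [show _ = _ from hx, union_singleton]
  have hdel : ∀ {P Q : Set (Pt d)}, Convex ℝ P → DeleteMove d P Q →
      ∃ v, extremePoints ℝ P = insert v (extremePoints ℝ Q) := by
    rintro P Q hP ⟨v, hv, rfl⟩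
    refine ⟨v, ?_⟩
    have : extremePoints ℝ (convexHull ℝ (extremePoints ℝ P \ {v})) = extremePoints ℝ P \ {v} := by
      refine extremePoints_convexHull_subset.antisymm fun w hw => ?_
      exact inter_extremePoints_subset_extremePoints_of_subset
        (convexHull_min (sdiff_subset.trans extremePoints_subset) hP)
        ⟨subset_convexHull ℝ _ hw, hw.1⟩
    rw [this, insert_sdiff_singleton, insert_eq_of_mem hv.1]
  rcases h with h | h | h | h
  · obtain ⟨v, hv⟩ := hins h
    exact ⟨v, .inl hv⟩
  · obtain ⟨v, hv⟩ := hdel hP h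
    exact ⟨v, .inr hv⟩
  · obtain ⟨v, hv⟩ := hins h
    exact ⟨v, .inr hv⟩
  · obtain ⟨v, hv⟩ := hdel hQ h
    exact ⟨v, .inl hv⟩

lemma extremePoints_convexHull_eq_of_exposed {E : Type*} [AddCommGroup E] [Module ℝ E] {S : Set E}
    (h : ∀ v ∈ S, ∃ l : E →ₗ[ℝ] ℝ, ∀ w ∈ S, w ≠ v → l v < l w) :
    extremePoints ℝ (convexHull ℝ S) = S := by
  refine extremePoints_convexHull_subset.antisymm fun v hv => ?_
  obtain ⟨l, hl⟩ := h v hv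
  have hsub : convexHull ℝ S ⊆ {x | x ≠ v → l v < l x} := by
    refine convexHull_min hl (convex_iff_pairwise_pos.mpr fun x hx y hy hxy a b ha hb hab _ => ?_)
    have hlin : l (a • x + b • y) - l v = a * (l x - l v) + b * (l y - l v) := by
      simp only [map_add, map_smul, smul_eq_mul]
      linear_combination (l v) * hab
    rw [← sub_pos, hlin]
    rcases eq_or_ne x v with rfl | hxv
    · simpa [hb] using hy hxy.symm
    · have h1 := mul_pos ha (sub_pos.mpr (hx hxv))
      rcases eq_or_ne y v with rfl | hyv
      · simpa using h1
      · have h2 := mul_pos hb (sub_pos.mpr (hy hyv))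
        linarith
  refine ⟨subset_convexHull ℝ S hv, fun x hx y hy ⟨a, b, ha, hb, hab, hxy⟩ => ?_⟩
  by_contra hxv
  have hlin : l v = a * l x + b * l y := by rw [← hxy]; simp
  have h1 := mul_pos ha (sub_pos.mpr (hsub hx hxv))
  have h2 : 0 ≤ b * (l y - l v) := by
    refine mul_nonneg hb.le (sub_nonneg.mpr ?_)
    rcases eq_or_ne y v with rfl | hyv
    · rfl
    · exact (hsub hy hyv).le
  have h3 : (a + b) * l v = l v := by rw [hab, one_mul]
  linarith

lemma card_le_two_of_collinear {E : Type*} [AddCommGroup E] [Module ℝ E] {C : Set E}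
    {W : Finset E} (hW : (W : Set E) ⊆ extremePoints ℝ C) (hcol : Collinear ℝ (W : Set E)) :
    W.card ≤ 2 := by
  have hbtw : ∀ x ∈ W, ∀ y ∈ W, ∀ z ∈ W, x ≠ y → y ≠ z → ¬ Wbtw ℝ x y z := by
    intro x hx y hy z hz hxy hyz h
    have hs : y ∈ openSegment ℝ x z := by
      have hmem := mem_segment_iff_wbtw.mpr h
      rw [← insert_endpoints_openSegment] at hmem
      exact (hmem.resolve_left hxy.symm).resolve_left hyz
    exact hxy ((hW hy).2 (hW hx).1 (hW hz).1 hs)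
  by_contra! h
  obtain ⟨x, y, z, hx, hy, hz, hxy, hxz, hyz⟩ := Finset.two_lt_card_iff.mp h
  have hcol3 : Collinear ℝ {x, y, z} := hcol.subset (by
    rintro w (rfl | rfl | rfl) <;> assumption)
  rcases hcol3.wbtw_or_wbtw_or_wbtw with h | h | h
  · exact hbtw x hx y hy z hz hxy hyz h
  · exact hbtw y hy z hz x hx hyz hxz.symm h
  · exact hbtw z hz x hx y hy hxz.symm hxy h

/-- If a positive combination of `u`, `v`, `w` with the right total mass equals a multiple of `p`,
then `p` and `u`, `v`, `w` are not all extreme points of the same set. -/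
lemma not_mem_extremePoints_of_combination {E : Type*} [AddCommGroup E] [Module ℝ E] {C : Set E}
    (hC : Convex ℝ C) {p u v w : E} {α β γ : ℝ} (hα : 0 < α) (hβ : 0 < β) (hγ : 0 < γ)
    (hp : (α + β + γ) • p = α • u + β • v + γ • w) (hu : u ∈ C) (hv : v ∈ C) (hw : w ∈ C)
    (hup : u ≠ p) : p ∉ extremePoints ℝ C := by
  intro hpC
  have hz : (β / (β + γ)) • v + (γ / (β + γ)) • w ∈ C :=
    hC hv hw (by positivity) (by positivity) (by field_simp)
  refine hup (hpC.2 hu hz ⟨α / (α + β + γ), (β + γ) / (α + β + γ), by positivity, by positivity,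
    by field_simp; ring, ?_⟩)
  have hne : α + β + γ ≠ 0 := by positivity
  rw [← smul_right_inj hne, hp]
  simp only [smul_add, smul_smul, ← add_assoc]
  congr 2
  · congr 2
    field_simp
  · congr 1
    field_simp
  · field_simp

/-- The `j`-th standard basis vector of `ℝ^d`, or `0` if `d ≤ j`. -/
def stdVec (d j : ℕ) : Pt d := fun i => if (i : ℕ) = j then 1 else 0

/-- The linear functional on `ℝ^d` with coefficients `c`. -/
def coeffForm (d : ℕ) (c : ℕ → ℝ) : Pt d →ₗ[ℝ] ℝ := ∑ i : Fin d, c i • LinearMap.proj i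

lemma coeffForm_stdVec {d j : ℕ} (c : ℕ → ℝ) :
    coeffForm d c (stdVec d j) = if j < d then c j else 0 := by
  simp only [coeffForm, stdVec, LinearMap.sum_apply, LinearMap.smul_apply, LinearMap.proj_apply,
    smul_eq_mul, mul_ite, mul_one, mul_zero]
  split_ifs with h
  · rw [Finset.sum_eq_single ⟨j, h⟩]
    · simp
    · intro i _ hi
      rw [if_neg fun h => hi (Fin.ext h)]
    · simp
  · exact Finset.sum_eq_zero fun i _ => if_neg (by omega)

/-- The index paired with `j` in the partition of `ℕ` into the pairs `{2k, 2k + 1}`. -/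
def partner (j : ℕ) : ℕ := if j % 2 = 0 then j + 1 else j - 1

/-- Points on an upward parabola. -/
def upperPt (d a : ℕ) : Pt d := (a : ℝ) • stdVec d 0 + ((a : ℝ) ^ 2) • stdVec d 1

/-- Points on a downward parabola, far below the points `upperPt d a`. -/
def lowerPt (d n a : ℕ) : Pt d :=
  (a : ℝ) • stdVec d 0 + (-((n + 1 : ℝ) ^ 2) - (a : ℝ) ^ 2) • stdVec d 1

/-- The reflection of `stdVec d (partner j)` in `stdVec d j`. -/
def reflVec (d j : ℕ) : Pt d := (2 : ℝ) • stdVec d j - stdVec d (partner j)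

/-- The vertices of the first polytope: points on a parabola and standard basis vectors. -/
def upperVertex (d i : ℕ) : Pt d := if 2 ≤ i ∧ i < d then stdVec d i else upperPt d i

/-- The vertices of the second polytope: points on a parabola and reflected basis vectors. -/
def lowerVertex (d n i : ℕ) : Pt d := if 2 ≤ i ∧ i < d then reflVec d i else lowerPt d n i

lemma coeffForm_upperPt {d : ℕ} (hd : 2 ≤ d) (c : ℕ → ℝ) (a : ℕ) :
    coeffForm d c (upperPt d a) = a * c 0 + a ^ 2 * c 1 := by
  simp [upperPt, coeffForm_stdVec, show 0 < d by omega, show 1 < d by omega]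

lemma coeffForm_lowerPt {d : ℕ} (hd : 2 ≤ d) (c : ℕ → ℝ) (n a : ℕ) :
    coeffForm d c (lowerPt d n a) = a * c 0 + (-((n + 1) ^ 2) - a ^ 2) * c 1 := by
  simp [lowerPt, coeffForm_stdVec, show 0 < d by omega, show 1 < d by omega]

lemma coeffForm_reflVec {d j : ℕ} (hj : j < d) (c : ℕ → ℝ) :
    coeffForm d c (reflVec d j) = 2 * c j - if partner j < d then c (partner j) else 0 := by
  simp [reflVec, coeffForm_stdVec, hj]

lemma sub_sq_pos_of_ne {a b : ℕ} (h : a ≠ b) : 0 < ((a : ℝ) - b) ^ 2 := by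
  have : (a : ℝ) ≠ b := by exact_mod_cast h
  have := sub_ne_zero.mpr this
  positivity

lemma exists_coeffForm_upperVertex_lt {d : ℕ} (hd : 2 ≤ d) (i : ℕ) :
    ∃ c, ∀ j, j ≠ i → coeffForm d c (upperVertex d i) < coeffForm d c (upperVertex d j) := by
  by_cases hi : 2 ≤ i ∧ i < d
  · refine ⟨fun k => if k = i then -1 else 0, fun j hj => ?_⟩
    simp only [upperVertex, if_pos hi]
    split_ifs with h
    · simp [coeffForm_stdVec, hi, h, hj]
    · simp [coeffForm_stdVec, coeffForm_upperPt hd, hi, show 0 ≠ i by omega, show 1 ≠ i by omega]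
  · refine ⟨fun k => if k = 0 then -2 * i else 1, fun j hj => ?_⟩
    simp only [upperVertex, if_neg hi]
    split_ifs with h
    · simp only [coeffForm_stdVec, coeffForm_upperPt hd, if_pos h.2, show j ≠ 0 by omega]
      norm_num
      nlinarith
    · simp only [coeffForm_upperPt hd]
      norm_num
      nlinarith [sub_sq_pos_of_ne hj]

lemma exists_coeffForm_lowerVertex_lt {d : ℕ} (hd : 2 ≤ d) (n i : ℕ) :
    ∃ c, ∀ j, j ≠ i →
      coeffForm d c (lowerVertex d n i) < coeffForm d c (lowerVertex d n j) := by
  by_cases hi : 2 ≤ i ∧ i < d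
  · refine ⟨fun k => if k = i then -2 else if k = partner i then -1 else 0, fun j hj => ?_⟩
    have hpi : partner i ≠ i ∧ 2 ≤ partner i := by unfold partner; split_ifs <;> omega
    simp only [lowerVertex, if_pos hi]
    refine lt_of_le_of_lt (b := -3) ?_ (lt_of_lt_of_le (b := 0) (by norm_num) ?_)
    · rw [coeffForm_reflVec hi.2]
      simp only [hpi.1, if_true, if_false]
      split_ifs <;> norm_num
    split_ifs with h
    · rw [coeffForm_reflVec h.2]
      by_cases hji : j = partner i
      · have hpj : partner j = i := by subst hji; unfold partner; split_ifs <;> omega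
        rw [hpj, if_pos hi.2, if_neg hj, if_pos hji, if_pos rfl]
        norm_num
      · have h1 : partner j ≠ i := by
          rintro rfl; apply hji; unfold partner; split_ifs <;> omega
        have h2 : partner j ≠ partner i := by
          intro h; apply hj; unfold partner at h; split_ifs at h <;> omega
        simp [hj, hji, h1, h2]
    · simp [coeffForm_lowerPt hd, show 0 ≠ i by omega, show 1 ≠ i by omega,
        show 0 ≠ partner i by omega, show 1 ≠ partner i by omega]
  · refine ⟨fun k => if k = 0 then -2 * i else if k = 1 then -1 else (n + 1) ^ 2 + 1,
      fun j hj => ?_⟩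
    simp only [lowerVertex, if_neg hi]
    split_ifs with h
    · have hpj : 2 ≤ partner j := by unfold partner; split_ifs <;> omega
      rw [coeffForm_lowerPt hd, coeffForm_reflVec h.2, if_neg (show j ≠ 0 by omega),
        if_neg (show j ≠ 1 by omega), if_neg (show partner j ≠ 0 by omega),
        if_neg (show partner j ≠ 1 by omega), if_pos rfl, if_neg one_ne_zero, if_pos rfl]
      split_ifs <;> nlinarith [sq_nonneg (n + 1 : ℝ)]
    · rw [coeffForm_lowerPt hd, coeffForm_lowerPt hd, if_pos rfl, if_neg one_ne_zero, if_pos rfl]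
      nlinarith [sub_sq_pos_of_ne hj]

lemma upperVertex_injective {d : ℕ} (hd : 2 ≤ d) : Function.Injective (upperVertex d) := by
  intro i j hij
  by_contra hne
  obtain ⟨c, hc⟩ := exists_coeffForm_upperVertex_lt hd i
  exact absurd (hij ▸ hc j (Ne.symm hne)) (lt_irrefl _)

lemma lowerVertex_injective {d : ℕ} (hd : 2 ≤ d) (n : ℕ) :
    Function.Injective (lowerVertex d n) := by
  intro i j hij
  by_contra hne
  obtain ⟨c, hc⟩ := exists_coeffForm_lowerVertex_lt hd n i
  exact absurd (hij ▸ hc j (Ne.symm hne)) (lt_irrefl _)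

lemma upperVertex_ne_lowerVertex {d : ℕ} (hd : 2 ≤ d) (n i j : ℕ) :
    upperVertex d i ≠ lowerVertex d n j := by
  intro h
  by_cases hj : 2 ≤ j ∧ j < d
  · have h1 := congrArg (fun v : Pt d => v ⟨j, hj.2⟩) h
    have hpj : j ≠ partner j := by unfold partner; split_ifs <;> omega
    have h2 : upperVertex d i ⟨j, hj.2⟩ ≤ 1 := by
      unfold upperVertex
      split_ifs
      · simp only [stdVec]
        split_ifs <;> norm_num
      · simp [upperPt, stdVec, show j ≠ 0 by omega, show j ≠ 1 by omega]
    simp only [h1, lowerVertex, if_pos hj] at h2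
    simp [reflVec, stdVec, hpj] at h2
  · have h1 := congrArg (fun v : Pt d => v ⟨1, by omega⟩) h
    have h2 : 0 ≤ upperVertex d i ⟨1, by omega⟩ := by
      unfold upperVertex
      split_ifs with hi
      · simp [stdVec, show 1 ≠ i by omega]
      · simp [upperPt, stdVec]
    simp only [h1, lowerVertex, if_neg hj] at h2
    simp [lowerPt, stdVec] at h2
    have h3 : (0 : ℝ) < (n + 1) ^ 2 := by positivity
    linarith [sq_nonneg (j : ℝ)]

lemma vectorSpan_eq_top_of_stdVec_mem {d : ℕ} {S : Set (Pt d)}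
    (h : ∀ j < d, stdVec d j ∈ vectorSpan ℝ S) : vectorSpan ℝ S = ⊤ := by
  refine eq_top_iff.mpr fun x _ => ?_
  have hx : x = ∑ i : Fin d, x i • stdVec d i := by
    ext k
    simp [stdVec, Finset.sum_apply, Fin.val_inj]
  rw [hx]
  exact Submodule.sum_mem _ fun i _ => Submodule.smul_mem _ _ (h i i.2)

lemma stdVec_mem_of_two_points {d : ℕ} (hd : 2 ≤ d) {U : Submodule ℝ (Pt d)} {s : ℝ}
    (hs : s ≠ 0) (h1 : stdVec d 0 + s • stdVec d 1 ∈ U)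
    (h2 : (d : ℝ) • stdVec d 0 + (s * (d : ℝ) ^ 2) • stdVec d 1 ∈ U) :
    stdVec d 0 ∈ U ∧ stdVec d 1 ∈ U := by
  have hd' : (2 : ℝ) ≤ d := by exact_mod_cast hd
  have hne : s * ((d : ℝ) ^ 2 - d) ≠ 0 := mul_ne_zero hs (by nlinarith)
  have h3 : stdVec d 1 ∈ U := by
    rw [← U.smul_mem_iff hne]
    convert U.sub_mem h2 (U.smul_mem (d : ℝ) h1) using 1
    module
  refine ⟨?_, h3⟩
  convert U.sub_mem h1 (U.smul_mem s h3) using 1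
  module

lemma fullDim_upper {d n : ℕ} (hd : 2 ≤ d) (hn : d + 1 ≤ n) :
    FullDim d (convexHull ℝ (upperVertex d '' Iio (n + 1))) := by
  have hmem : ∀ i < n + 1, upperVertex d i ∈ upperVertex d '' Iio (n + 1) :=
    fun i hi => mem_image_of_mem _ hi
  rw [FullDim, affineSpan_convexHull,
    AffineSubspace.affineSpan_eq_top_iff_vectorSpan_eq_top_of_nonempty ℝ _ _ ⟨_, hmem 0 (by omega)⟩]
  have hsub : ∀ i < n + 1, upperVertex d i ∈ vectorSpan ℝ (upperVertex d '' Iio (n + 1)) := by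
    intro i hi
    have := vsub_mem_vectorSpan ℝ (hmem i hi) (hmem 0 (by omega))
    simpa [show upperVertex d 0 = 0 by simp [upperVertex, upperPt]] using this
  have h01 := stdVec_mem_of_two_points hd (s := 1) one_ne_zero
    (by simpa [upperVertex, upperPt] using hsub 1 (by omega))
    (by simpa [upperVertex, upperPt] using hsub d (by omega))
  refine vectorSpan_eq_top_of_stdVec_mem fun j hj => ?_
  rcases lt_or_ge j 2 with h | h
  · interval_cases j
    exacts [h01.1, h01.2]
  · simpa [upperVertex, h, hj] using hsub j (by omega)

lemma fullDim_lower {d n : ℕ} (hd : 2 ≤ d) (hn : d + 1 ≤ n) :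
    FullDim d (convexHull ℝ (lowerVertex d n '' Iio (n + 1))) := by
  have hmem : ∀ i < n + 1, lowerVertex d n i ∈ lowerVertex d n '' Iio (n + 1) :=
    fun i hi => mem_image_of_mem _ hi
  rw [FullDim, affineSpan_convexHull,
    AffineSubspace.affineSpan_eq_top_iff_vectorSpan_eq_top_of_nonempty ℝ _ _ ⟨_, hmem 0 (by omega)⟩]
  set U := vectorSpan ℝ (lowerVertex d n '' Iio (n + 1))
  have hsub : ∀ i < n + 1, lowerVertex d n i - lowerVertex d n 0 ∈ U :=
    fun i hi => vsub_mem_vectorSpan ℝ (hmem i hi) (hmem 0 (by omega))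
  have h01 : stdVec d 0 ∈ U ∧ stdVec d 1 ∈ U := by
    refine stdVec_mem_of_two_points hd (s := -1) (by norm_num) ?_ ?_
    · convert hsub 1 (by omega) using 1
      simp [lowerVertex, lowerPt]
      module
    · convert hsub d (by omega) using 1
      simp [lowerVertex, lowerPt]
      module
  have hrefl : ∀ j, 2 ≤ j → j < d → reflVec d j ∈ U := by
    intro j h2 hj
    have h0 : lowerVertex d n 0 ∈ U := by
      simpa [lowerVertex, lowerPt] using U.smul_mem (-((n + 1 : ℝ) ^ 2)) h01.2
    simpa [lowerVertex, h2, hj] using U.add_mem (hsub j (by omega)) h0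
  refine vectorSpan_eq_top_of_stdVec_mem fun j hj => ?_
  rcases lt_or_ge j 2 with h | h
  · interval_cases j
    exacts [h01.1, h01.2]
  have hpp : partner (partner j) = j := by unfold partner; split_ifs <;> omega
  have hp2 : 2 ≤ partner j := by unfold partner; split_ifs <;> omega
  rcases lt_or_ge (partner j) d with hp | hp
  · rw [← U.smul_mem_iff (show (3 : ℝ) ≠ 0 by norm_num)]
    convert U.add_mem (U.smul_mem (2 : ℝ) (hrefl j h hj)) (hrefl _ hp2 hp) using 1
    simp only [reflVec, hpp]
    module
  · rw [← U.smul_mem_iff (show (2 : ℝ) ≠ 0 by norm_num)]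
    convert hrefl j h hj using 1
    have : stdVec d (partner j) = 0 := by
      ext i
      simp [stdVec, show (i : ℕ) ≠ partner j by omega]
    simp [reflVec, this]

/-- At most two of the points `upperPt d a` are extreme in a set that contains a `lowerPt`. -/
lemma card_upperPt_le_two {d n w : ℕ} {C : Set (Pt d)} (hd : 2 ≤ d) (hC : Convex ℝ C)
    (hw : lowerPt d n w ∈ C) {T : Finset ℕ} (hTn : ∀ a ∈ T, a ≤ n)
    (hT : ∀ a ∈ T, upperPt d a ∈ extremePoints ℝ C) : T.card ≤ 2 := by
  by_contra! h
  obtain ⟨s, t, u, hs, ht, hu, hst, htu⟩ : ∃ s t u, s ∈ T ∧ t ∈ T ∧ u ∈ T ∧ s < t ∧ t < u := by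
    let f := T.orderEmbOfFin rfl
    have hf : ∀ i, f i ∈ T := T.orderEmbOfFin_mem rfl
    exact ⟨f ⟨0, by omega⟩, f ⟨1, by omega⟩, f ⟨2, by omega⟩, hf _, hf _, hf _,
      f.strictMono (by simp), f.strictMono (by simp)⟩
  have area : ∀ a b : ℕ, a < b → b ≤ n →
      0 < ((b : ℝ) - a) * ((a + b) * w - a * b + (n + 1) ^ 2 + w ^ 2) := by
    intro a b hab hb
    have h1 : (a : ℝ) < b := by exact_mod_cast hab
    have h2 : (b : ℝ) ≤ n := by exact_mod_cast hb
    have h0 : (0 : ℝ) ≤ a := by positivity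
    refine mul_pos (by linarith) ?_
    have h3 : (a : ℝ) * b ≤ n * n := by gcongr; linarith
    have h4 : (0 : ℝ) ≤ (a + b) * w := by positivity
    nlinarith
  have hst' : (s : ℝ) < t := by exact_mod_cast hst
  have htu' : (t : ℝ) < u := by exact_mod_cast htu
  have hδ : (0 : ℝ) < (t - s) * (u - t) * (u - s) :=
    mul_pos (mul_pos (by linarith) (by linarith)) (by linarith)
  refine not_mem_extremePoints_of_combination hC (area t u htu (hTn u hu))
    (area s t hst (hTn t ht)) hδ ?_ (hT s hs).1 (hT u hu).1 hw ?_ (hT t ht)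
  · simp only [upperPt, lowerPt]
    module
  · intro h
    have := congrArg (coeffForm d fun k => if k = 0 then 1 else 0) h
    simp [coeffForm_upperPt hd] at this
    omega

open scoped Finset in
/-- At most `d - 1` of the standard and reflected basis vectors are simultaneously extreme. -/
lemma card_inter_stdVec_union_reflVec_le {d : ℕ} [DecidableEq (Pt d)] {C : Set (Pt d)}
    {W : Finset (Pt d)} (hW : (W : Set (Pt d)) ⊆ extremePoints ℝ C) :
    #(W ∩ ((Finset.Ico 2 d).image (stdVec d) ∪ (Finset.Ico 2 d).image (reflVec d))) ≤ d - 1 := by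
  classical
  let line : ℕ → Set (Pt d) := fun k =>
    {x | ∃ r : ℝ, x = r • (stdVec d (2 * k + 1) - stdVec d (2 * k)) +ᵥ stdVec d (2 * k)}
  have hline : ∀ j, stdVec d j ∈ line (j / 2) ∧ reflVec d j ∈ line (j / 2) := by
    intro j
    rcases Nat.mod_two_eq_zero_or_one j with h | h
    · have h1 : partner j = j + 1 := if_pos h
      have h2 : 2 * (j / 2) = j := by omega
      constructor
      · exact ⟨0, by rw [h2, vadd_eq_add]; module⟩
      · exact ⟨-1, by rw [reflVec, h1, h2, vadd_eq_add]; module⟩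
    · have h1 : partner j = 2 * (j / 2) := by unfold partner; split_ifs <;> omega
      have h2 : 2 * (j / 2) + 1 = j := by omega
      constructor
      · exact ⟨1, by rw [h2, vadd_eq_add]; module⟩
      · exact ⟨2, by rw [reflVec, h1, h2, vadd_eq_add]; module⟩
  have hsub : W ∩ ((Finset.Ico 2 d).image (stdVec d) ∪ (Finset.Ico 2 d).image (reflVec d)) ⊆
      (Finset.Icc 1 ((d - 1) / 2)).biUnion fun k => W.filter (· ∈ line k) := by
    intro x hx
    simp only [Finset.mem_inter, Finset.mem_union, Finset.mem_image, Finset.mem_Ico] at hx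
    simp only [Finset.mem_biUnion, Finset.mem_Icc, Finset.mem_filter]
    obtain ⟨hxW, ⟨j, hj, rfl⟩ | ⟨j, hj, rfl⟩⟩ := hx
    · exact ⟨j / 2, by omega, hxW, (hline j).1⟩
    · exact ⟨j / 2, by omega, hxW, (hline j).2⟩
  have hcard := (Finset.card_le_card hsub).trans (Finset.card_biUnion_le_card_mul _ _ 2 ?_)
  · rw [Nat.card_Icc] at hcard
    omega
  · intro k _
    refine card_le_two_of_collinear (C := C) (fun x hx => hW (Finset.mem_of_mem_filter x hx)) ?_
    rw [collinear_iff_exists_forall_eq_smul_vadd]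
    exact ⟨_, _, fun x hx => (Finset.mem_filter.mp hx).2⟩

open scoped Finset in
/-- A set of extreme points containing exactly one `lowerPt` has few vertices in common with the
two polytopes. -/
lemma card_inter_upper_add_card_inter_lower_le {d n : ℕ} [DecidableEq (Pt d)] (hd : 2 ≤ d)
    {C : Set (Pt d)} (hC : Convex ℝ C) {W : Finset (Pt d)}
    (hW : (W : Set (Pt d)) ⊆ extremePoints ℝ C)
    (hWK : #(W ∩ ((Finset.range (n + 1)).filter fun i => ¬ (2 ≤ i ∧ i < d)).image
      (lowerPt d n)) = 1) :
    #(W ∩ (Finset.range (n + 1)).image (upperVertex d)) +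
      #(W ∩ (Finset.range (n + 1)).image (lowerVertex d n)) ≤ d + 2 := by
  obtain ⟨q, hq⟩ := Finset.card_pos.mp (hWK ▸ one_pos)
  obtain ⟨hqW, hqK⟩ := Finset.mem_inter.mp hq
  obtain ⟨w, -, rfl⟩ := Finset.mem_image.mp hqK
  set K := ((Finset.range (n + 1)).filter fun i => ¬ (2 ≤ i ∧ i < d)).image (lowerPt d n)
  set T := (Finset.range (n + 1)).filter fun i => upperPt d i ∈ W
  have hT : #T ≤ 2 := card_upperPt_le_two hd hC (hW hqW).1
    (fun a ha => by have := Finset.mem_range.mp (Finset.mem_filter.mp ha).1; omega)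
    (fun a ha => hW (Finset.mem_filter.mp ha).2)
  have hA : W ∩ (Finset.range (n + 1)).image (upperVertex d) ⊆
      T.image (upperPt d) ∪ W ∩ (Finset.Ico 2 d).image (stdVec d) := by
    intro x hx
    obtain ⟨hxW, hx⟩ := Finset.mem_inter.mp hx
    obtain ⟨i, hi, rfl⟩ := Finset.mem_image.mp hx
    unfold upperVertex at hxW ⊢
    split_ifs at hxW ⊢ with h
    · exact Finset.mem_union_right _ (Finset.mem_inter.mpr
        ⟨hxW, Finset.mem_image_of_mem _ (Finset.mem_Ico.mpr h)⟩)
    · exact Finset.mem_union_left _ (Finset.mem_image_of_mem _ (Finset.mem_filter.mpr ⟨hi, hxW⟩))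
  have hB : W ∩ (Finset.range (n + 1)).image (lowerVertex d n) ⊆
      (W ∩ K) ∪ W ∩ (Finset.Ico 2 d).image (reflVec d) := by
    intro x hx
    obtain ⟨hxW, hx⟩ := Finset.mem_inter.mp hx
    obtain ⟨i, hi, rfl⟩ := Finset.mem_image.mp hx
    unfold lowerVertex at hxW ⊢
    split_ifs at hxW ⊢ with h
    · exact Finset.mem_union_right _ (Finset.mem_inter.mpr
        ⟨hxW, Finset.mem_image_of_mem _ (Finset.mem_Ico.mpr h)⟩)
    · exact Finset.mem_union_left _ (Finset.mem_inter.mpr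
        ⟨hxW, Finset.mem_image_of_mem _ (Finset.mem_filter.mpr ⟨hi, h⟩)⟩)
  have hdisj : Disjoint (W ∩ (Finset.Ico 2 d).image (stdVec d))
      (W ∩ (Finset.Ico 2 d).image (reflVec d)) := by
    refine (Finset.disjoint_left.mpr fun x hx hx' => ?_).mono Finset.inter_subset_right
      Finset.inter_subset_right
    obtain ⟨i, hi, rfl⟩ := Finset.mem_image.mp hx
    obtain ⟨j, hj, hij⟩ := Finset.mem_image.mp hx'
    refine upperVertex_ne_lowerVertex hd n i j ?_
    rw [upperVertex, lowerVertex, if_pos (Finset.mem_Ico.mp hi), if_pos (Finset.mem_Ico.mp hj), hij]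
  have h1 := (Finset.card_le_card hA).trans (Finset.card_union_le _ _)
  have h2 := (Finset.card_le_card hB).trans (Finset.card_union_le _ _)
  have h3 := card_inter_stdVec_union_reflVec_le hW
  rw [Finset.inter_union_distrib_left, Finset.card_union_of_disjoint hdisj] at h3
  have h4 := (Finset.card_image_le (s := T) (f := upperPt d)).trans hT
  omega

lemma extremePoints_convexHull_upperVertex {d : ℕ} (hd : 2 ≤ d) (S : Set ℕ) :
    extremePoints ℝ (convexHull ℝ (upperVertex d '' S)) = upperVertex d '' S := by
  refine extremePoints_convexHull_eq_of_exposed ?_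
  rintro _ ⟨i, -, rfl⟩
  obtain ⟨c, hc⟩ := exists_coeffForm_upperVertex_lt hd i
  refine ⟨coeffForm d c, ?_⟩
  rintro _ ⟨j, -, rfl⟩ hj
  exact hc j fun h => hj (h ▸ rfl)

lemma extremePoints_convexHull_lowerVertex {d : ℕ} (hd : 2 ≤ d) (n : ℕ) (S : Set ℕ) :
    extremePoints ℝ (convexHull ℝ (lowerVertex d n '' S)) = lowerVertex d n '' S := by
  refine extremePoints_convexHull_eq_of_exposed ?_
  rintro _ ⟨i, -, rfl⟩
  obtain ⟨c, hc⟩ := exists_coeffForm_lowerVertex_lt hd n i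
  refine ⟨coeffForm d c, ?_⟩
  rintro _ ⟨j, -, rfl⟩ hj
  exact hc j fun h => hj (h ▸ rfl)

lemma convexHull_mem_NClass {d n : ℕ} {S : Finset (Pt d)}
    (hext : extremePoints ℝ (convexHull ℝ (S : Set (Pt d))) = S) (hcard : S.card = n + 1)
    (hfull : FullDim d (convexHull ℝ (S : Set (Pt d)))) :
    convexHull ℝ (S : Set (Pt d)) ∈ NClass d n :=
  ⟨⟨⟨S, rfl⟩, hfull⟩, .inr (by rw [nVerts, hext, ncard_coe_finset, hcard])⟩

lemma IsPolytope.convex {d : ℕ} {P : Set (Pt d)} (hP : IsPolytope d P) : Convex ℝ P := by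
  obtain ⟨S, rfl⟩ := hP
  exact convex_convexHull ℝ _

lemma IsPolytope.finite_extremePoints {d : ℕ} {P : Set (Pt d)} (hP : IsPolytope d P) :
    (extremePoints ℝ P).Finite := by
  obtain ⟨S, rfl⟩ := hP
  exact S.finite_toSet.subset extremePoints_convexHull_subset

/-- the subgraph of `Γ(d)` induced by the polytopes with `n` or `n+1`
vertices has diameter at least `4n - 2d`: some pair cannot be joined by a path of
fewer than `4n - 2d` edges within this subgraph. -/
theorem stmt_1 (d n : ℕ) (hd : 2 ≤ d) (hn : d + 1 ≤ n) :
    ∃ P ∈ NClass d n, ∃ Q ∈ NClass d n,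
      ∀ m : ℕ, m < 4 * n - 2 * d → ¬ PathLE d (NClass d n) P Q m := by
  classical
  set A := (Finset.range (n + 1)).image (upperVertex d)
  set B := (Finset.range (n + 1)).image (lowerVertex d n)
  have hAc : (A : Set (Pt d)) = upperVertex d '' Iio (n + 1) := by simp [A]
  have hBc : (B : Set (Pt d)) = lowerVertex d n '' Iio (n + 1) := by simp [B]
  have hAext : extremePoints ℝ (convexHull ℝ (A : Set (Pt d))) = A := by
    rw [hAc, extremePoints_convexHull_upperVertex hd]
  have hBext : extremePoints ℝ (convexHull ℝ (B : Set (Pt d))) = B := by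
    rw [hBc, extremePoints_convexHull_lowerVertex hd]
  have hAcard : A.card = n + 1 := by
    rw [Finset.card_image_of_injective _ (upperVertex_injective hd), Finset.card_range]
  have hBcard : B.card = n + 1 := by
    rw [Finset.card_image_of_injective _ (lowerVertex_injective hd n), Finset.card_range]
  refine ⟨_, convexHull_mem_NClass hAext hAcard (hAc ▸ fullDim_upper hd hn),
    _, convexHull_mem_NClass hBext hBcard (hBc ▸ fullDim_lower hd hn), ?_⟩
  rintro m hm ⟨k, f, hk, h0, hfk, hC, hmove⟩
  let V : ℕ → Finset (Pt d) := fun i =>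
    if h : (extremePoints ℝ (f i)).Finite then h.toFinset else ∅
  have hVc : ∀ i ≤ k, (V i : Set (Pt d)) = extremePoints ℝ (f i) := by
    intro i hi
    simp [V, (hC i hi).1.1.finite_extremePoints]
  set K := ((Finset.range (n + 1)).filter fun i => ¬ (2 ≤ i ∧ i < d)).image (lowerPt d n)
  have hKB : K ⊆ B := by
    intro x hx
    obtain ⟨i, hi, rfl⟩ := Finset.mem_image.mp hx
    obtain ⟨hi, hi'⟩ := Finset.mem_filter.mp hi
    exact Finset.mem_image.mpr ⟨i, hi, if_neg hi'⟩
  have hAB : Disjoint A B := by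
    refine Finset.disjoint_left.mpr fun x hx hx' => ?_
    obtain ⟨i, -, rfl⟩ := Finset.mem_image.mp hx
    obtain ⟨j, -, hij⟩ := Finset.mem_image.mp hx'
    exact upperVertex_ne_lowerVertex hd n i j hij.symm
  have hlen := le_length_of_first_meeting (d := d) hAcard hBcard hAB hKB
    ⟨_, Finset.mem_image_of_mem _ (Finset.mem_filter.mpr ⟨Finset.mem_range.mpr n.succ_pos,
      by omega⟩)⟩
    (V := V) (m := k)
    (by rw [← Finset.coe_inj, hVc 0 (Nat.zero_le k), h0, hAext])
    (by rw [← Finset.coe_inj, hVc k le_rfl, hfk, hBext])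
    (fun i hi => by
      have := (hC i hi).2
      rwa [nVerts, ← hVc i hi, ncard_coe_finset] at this)
    (fun i hi => by
      have := (hmove i hi).extremePoints_eq_insert (hC i hi.le).1.1.convex (hC _ hi).1.1.convex
      simp only [← hVc i hi.le, ← hVc (i + 1) hi] at this
      exact_mod_cast this)
    (fun i hi h => card_inter_upper_add_card_inter_lower_le hd (hC i hi).1.1.convex
      (hVc i hi).le h)
  omega
end
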